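/- arXiv:2511.01050 — 10 statements merged into one kernel-verified Lean document; each statement's English description precedes it below -/
import Mathlib

section
/- Let U be a nonprincipal ultrafilter on ω. Then U^{<ω} is a P⁺-filter if and only if (ω^ω,≤) is NOT Tukey reducible to (U,⊇), i.e. there is no map f : U → ω^ω sending every cofinal subset of (U,⊇) to a dominating family in (ω^ω,≤). -/
open Set Filter

/-- `D` is cofinal in the quasi-order `r`: every point is `r`-below some element of `D`. -/
def CofinalIn {α : Type*} (r : α → α → Prop) (D : Set α) : Prop :=
  ∀ p : α, ∃ d ∈ D, r p d

/-- `(β, rQ)` is Tukey reducible to `(α, rP)`: there is a map `α → β`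
sending every cofinal subset of `(α, rP)` to a cofinal subset of `(β, rQ)`. -/
def TukeyLE {β α : Type*} (rQ : β → β → Prop) (rP : α → α → Prop) : Prop :=
  ∃ f : α → β, ∀ D : Set α, CofinalIn rP D → CofinalIn rQ (f '' D)

/-- The quasi-order `(U, ⊇)` on the members of an ultrafilter `U`. -/
def UFOrder (U : Ultrafilter ℕ) : {A : Set ℕ // A ∈ U} → {A : Set ℕ // A ∈ U} → Prop :=
  fun A B => B.1 ⊆ A.1

/-- Everywhere domination order on `ω^ω`. -/
def domLE (f g : ℕ → ℕ) : Prop := ∀ n, f n ≤ g n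

/-- Eventual domination order `≤*` on `ω^ω`. -/
def evDomLE (f g : ℕ → ℕ) : Prop := ∀ᶠ n in atTop, f n ≤ g n

/-- `[A]^{<ω}`: the nonempty finite subsets of `A`. -/
def FinCube (A : Set ℕ) : Set (Finset ℕ) := {s | s.Nonempty ∧ ↑s ⊆ A}

/-- `X ⊆ FIN` is `U^{<ω}`-positive: it consists of nonempty finite sets and
meets `[A]^{<ω}` for every `A ∈ U`. -/
def UPositive (U : Ultrafilter ℕ) (X : Set (Finset ℕ)) : Prop :=
  (∀ s ∈ X, s.Nonempty) ∧ ∀ A ∈ U, (X ∩ FinCube A).Nonempty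

/-- `U^{<ω}` is a P⁺-filter: every ⊆-decreasing sequence of `U^{<ω}`-positive sets
has a `U^{<ω}`-positive pseudo-intersection. -/
def PPlus (U : Ultrafilter ℕ) : Prop :=
  ∀ X : ℕ → Set (Finset ℕ),
    (∀ n, UPositive U (X n)) → (∀ n, X (n + 1) ⊆ X n) →
    ∃ Y : Set (Finset ℕ), UPositive U Y ∧ ∀ n, (Y \ X n).Finite

/-- A Tukey map from `U` to `ω^ω` yields a monotone map with dominating image. -/
lemma TukeyLE.exists_monotone {U : Ultrafilter ℕ} (h : TukeyLE domLE (UFOrder U)) :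
    ∃ g : Set ℕ → ℕ → ℕ, (∀ A ∈ U, ∀ B, A ⊆ B → ∀ n, g B n ≤ g A n) ∧
      ∀ p : ℕ → ℕ, ∃ A ∈ U, ∀ n, p n ≤ g A n := by
  obtain ⟨f, hf⟩ := h
  refine ⟨fun A n => sInf {k | ∃ B : {B : Set ℕ // B ∈ U}, B.1 ⊆ A ∧ f B n = k}, ?_, ?_⟩
  · intro A hA B hAB n
    obtain ⟨C, hCA, hC⟩ := Nat.sInf_mem
      (s := {k | ∃ B : {B : Set ℕ // B ∈ U}, B.1 ⊆ A ∧ f B n = k})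
      ⟨_, ⟨A, hA⟩, Subset.rfl, rfl⟩
    exact Nat.sInf_le ⟨C, hCA.trans hAB, hC⟩
  · intro p
    by_contra! hp
    have hcof : CofinalIn (UFOrder U) {B | ¬ domLE p (f B)} := by
      rintro ⟨A, hA⟩
      obtain ⟨n, hn⟩ := hp A hA
      obtain ⟨C, hCA, hC⟩ := Nat.sInf_mem
        (s := {k | ∃ B : {B : Set ℕ // B ∈ U}, B.1 ⊆ A ∧ f B n = k})
        ⟨_, ⟨A, hA⟩, Subset.rfl, rfl⟩
      refine ⟨C, fun hdom => ?_, hCA⟩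
      have := hdom n
      omega
    obtain ⟨_, ⟨B, hB, rfl⟩, hpB⟩ := hf _ hcof p
    exact hB hpB

/-- If `U^{<ω}` is a P⁺-filter then `U` is a P-point. -/
lemma PPlus.exists_pseudoIntersection {U : Ultrafilter ℕ} (h : PPlus U) {D : ℕ → Set ℕ}
    (hD : ∀ n, D n ∈ U) (hanti : Antitone D) : ∃ C ∈ U, ∀ n, (C \ D n).Finite := by
  obtain ⟨Y, hY, hfin⟩ := h (fun n => FinCube (D n))
    (fun n => ⟨fun s hs => hs.1, fun A hA => by
      obtain ⟨x, hxD, hxA⟩ := U.nonempty_of_mem (inter_mem (hD n) hA)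
      exact ⟨{x}, ⟨by simp, by simpa using hxD⟩, by simp, by simpa using hxA⟩⟩)
    (fun n s hs => ⟨hs.1, hs.2.trans (hanti n.le_succ)⟩)
  refine ⟨⋃ s ∈ Y, (s : Set ℕ), ?_, fun n => ?_⟩
  · by_contra hC
    obtain ⟨s, hsY, ⟨x, hx⟩, hs⟩ := hY.2 _ (Ultrafilter.compl_mem_iff_notMem.2 hC)
    exact hs hx (mem_biUnion hsY hx)
  · refine ((hfin n).biUnion fun s _ => s.finite_toSet).subset ?_
    rintro x ⟨hx, hxD⟩
    obtain ⟨s, hsY, hxs⟩ := mem_iUnion₂.1 hx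
    exact mem_biUnion ⟨hsY, fun hs => hxD (hs.2 hxs)⟩ hxs

/-- Every ultrafilter has a member that omits `[m, h m)` for arbitrarily large `m`. -/
lemma Ultrafilter.exists_mem_with_gaps (U : Ultrafilter ℕ) (h : ℕ → ℕ) :
    ∃ E ∈ U, ∀ N, ∃ m ≥ N, ∀ x ∈ E, m ≤ x → h m ≤ x := by
  let m : ℕ → ℕ := fun i => Nat.rec 0 (fun _ a => max (a + 1) (h a)) i
  have hsucc : ∀ i, m (i + 1) = max (m i + 1) (h (m i)) := fun _ => rfl
  have hmono : StrictMono m := strictMono_nat_of_lt_succ fun i => by rw [hsucc]; omega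
  have hstep : ∀ i, h (m i) ≤ m (i + 1) := fun i => by rw [hsucc]; omega
  let E : Set ℕ := {x | ∃ i, Even i ∧ m i ≤ x ∧ x < m (i + 1)}
  by_cases hE : E ∈ U
  · refine ⟨E, hE, fun N => ⟨m (2 * N + 1), ?_, ?_⟩⟩
    · have := hmono.le_apply (x := 2 * N + 1)
      omega
    · rintro x ⟨j, hj, hjx, hxj⟩ hx
      by_contra! hlt
      have h1 : 2 * N + 1 < j + 1 := hmono.lt_iff_lt.1 (hx.trans_lt hxj)
      have h2 : j < 2 * N + 1 + 1 :=
        hmono.lt_iff_lt.1 (hjx.trans_lt (hlt.trans_le (hstep (2 * N + 1))))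
      obtain ⟨r, rfl⟩ := hj
      omega
  · refine ⟨Eᶜ, Ultrafilter.compl_mem_iff_notMem.2 hE, fun N => ⟨m (2 * N), ?_, ?_⟩⟩
    · have := hmono.le_apply (x := 2 * N)
      omega
    · intro x hxE hx
      by_contra! hlt
      exact hxE ⟨2 * N, even_two_mul N, hx, hlt.trans_le (hstep (2 * N))⟩

/-- For a P-point, a monotone map `U → ω` is bounded on the members of `U` containing
a suitable finite subset of any prescribed member of `U`. -/
lemma PPlus.exists_finset_bound {U : Ultrafilter ℕ} (h : PPlus U) {φ : Set ℕ → ℕ}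
    (hφ : ∀ A ∈ U, ∀ B, A ⊆ B → φ B ≤ φ A) {A : Set ℕ} (hA : A ∈ U) :
    ∃ s : Finset ℕ, ↑s ⊆ A ∧ ∃ k, ∀ B ∈ U, ↑s ⊆ B → φ B ≤ k := by
  by_contra! hunb
  have hB : ∀ (s : Finset ℕ) (k : ℕ), ∃ B ∈ U, ↑s ⊆ A → ↑s ⊆ B ∧ k < φ B := by
    intro s k
    by_cases hs : ↑s ⊆ A
    · obtain ⟨B, hBU, hsB, hk⟩ := hunb s hs k
      exact ⟨B, hBU, fun _ => ⟨hsB, hk⟩⟩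
    · exact ⟨A, hA, fun h => absurd h hs⟩
  choose B hBU hB using hB
  obtain ⟨C, hC, hfin⟩ := h.exists_pseudoIntersection
    (D := fun k => ⋂ j ∈ Finset.range (k + 1), ⋂ s ∈ (Finset.range j).powerset, B s j)
    (fun k => (biInter_finset_mem _).2 fun j _ => (biInter_finset_mem _).2 fun s _ => hBU s j)
    (fun k l hkl => biInter_subset_biInter_left fun j hj => by
      simp only [Finset.mem_range, SetLike.mem_coe] at hj ⊢
      omega)
  choose b hb using fun n => (hfin n).bddAbove
  obtain ⟨E, hE, hgap⟩ := U.exists_mem_with_gaps (fun n => b n + 1)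
  have hZ : A ∩ C ∩ E ∈ U := inter_mem (inter_mem hA hC) hE
  obtain ⟨m, hm, hgap⟩ := hgap (φ (A ∩ C ∩ E))
  classical
  let s := (Finset.range m).filter (· ∈ A ∩ C ∩ E)
  obtain ⟨hsB, hlt⟩ := hB s m fun x hx => (Finset.mem_filter.1 hx).2.1.1
  have hsub : A ∩ C ∩ E ⊆ B s m := by
    intro x hx
    rcases lt_or_ge x m with hxm | hxm
    · exact hsB (Finset.mem_filter.2 ⟨Finset.mem_range.2 hxm, hx⟩)
    · have hbx := hgap x hx.2 hxm
      by_contra hxB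
      have : x ≤ b m := hb m ⟨hx.1.2, fun hxD => hxB
        (mem_iInter₂.1 (mem_iInter₂.1 hxD m (by simp)) s (by simp [s]))⟩
      omega
  have := hφ _ hZ _ hsub
  omega

lemma PPlus.not_tukeyLE {U : Ultrafilter ℕ} (hU : ∀ a : ℕ, U ≠ pure a) (h : PPlus U) :
    ¬ TukeyLE domLE (UFOrder U) := by
  intro hT
  obtain ⟨g, hg, hdom⟩ := hT.exists_monotone
  have hcof : (U : Filter ℕ) ≤ cofinite := by
    rcases U.le_cofinite_or_eq_pure with hc | ⟨a, ha⟩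
    · exact hc
    · exact absurd ha (hU a)
  let X : ℕ → Set (Finset ℕ) := fun n => {s | (∃ x ∈ s, n ≤ x) ∧
    ∀ j ≤ n, ∃ k, ∀ B ∈ U, ↑s ⊆ B → g B j ≤ k}
  have hX : ∀ n, UPositive U (X n) := by
    refine fun n => ⟨fun s ⟨⟨x, hx, _⟩, _⟩ => ⟨x, hx⟩, fun A hA => ?_⟩
    choose t htA k hk using fun j => h.exists_finset_bound (φ := fun B => g B j)
      (fun A hA B hAB => hg A hA B hAB j) hA
    obtain ⟨x, hxA, hx⟩ := U.nonempty_of_mem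
      (inter_mem hA (hcof (finite_Iio n).compl_mem_cofinite))
    have hx : n ≤ x := by simpa using hx
    refine ⟨insert x ((Finset.range (n + 1)).biUnion t),
      ⟨⟨x, by simp, hx⟩, fun j hj => ⟨k j, fun B hB hsB => hk j B hB ?_⟩⟩, by simp, ?_⟩
    · refine Subset.trans (fun y hy => ?_) hsB
      exact Finset.mem_insert_of_mem
        (Finset.mem_biUnion.2 ⟨j, Finset.mem_range.2 (by omega), hy⟩)
    · intro y hy
      rcases Finset.mem_insert.1 hy with rfl | hy
      · exact hxA
      · obtain ⟨j, _, hj⟩ := Finset.mem_biUnion.1 hy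
        exact htA j hj
  obtain ⟨Y, hY, hfin⟩ := h X hX fun n s ⟨⟨x, hx, hnx⟩, hs⟩ =>
    ⟨⟨x, hx, by omega⟩, fun j hj => hs j (by omega)⟩
  have hK : ∀ (s : Finset ℕ) (n : ℕ), ∃ k, s ∈ X n → ∀ B ∈ U, ↑s ⊆ B → g B n ≤ k := by
    intro s n
    by_cases hs : s ∈ X n
    · obtain ⟨k, hk⟩ := hs.2 n le_rfl
      exact ⟨k, fun _ => hk⟩
    · exact ⟨0, fun h => absurd h hs⟩
  choose K hK using hK
  obtain ⟨A, hA, hpA⟩ := hdom fun n => (hfin (n + 1)).toFinset.sup (fun s => K s n) + 1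
  have hF : (⋃ s ∈ Y \ X 0, (s : Set ℕ))ᶜ ∈ U :=
    hcof ((hfin 0).biUnion fun s _ => s.finite_toSet).compl_mem_cofinite
  obtain ⟨s, hsY, ⟨y, hy⟩, hs⟩ := hY.2 _ (inter_mem hA hF)
  have hs0 : s ∈ X 0 := by
    by_contra hs0
    exact (hs hy).2 (mem_biUnion ⟨hsY, hs0⟩ hy)
  have hex : ∃ n, s ∈ X n ∧ s ∉ X (n + 1) := by
    by_contra! hall
    have hall : ∀ n, s ∈ X n := fun n => Nat.rec hs0 (fun n ih => hall n ih) n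
    obtain ⟨⟨x, hx, hlt⟩, _⟩ := hall (s.sup id + 1)
    have := Finset.le_sup (f := id) hx
    simp only [id] at this hlt
    omega
  obtain ⟨n, hn, hn'⟩ := hex
  have h1 := hK s n hn A hA fun x hx => (hs hx).1
  have h2 := hpA n
  have h3 : K s n ≤ (hfin (n + 1)).toFinset.sup (fun s => K s n) :=
    Finset.le_sup (f := fun s => K s n) ((hfin (n + 1)).mem_toFinset.2 ⟨hsY, hn'⟩)
  omega

lemma tukeyLE_of_not_pPlus {U : Ultrafilter ℕ} (h : ¬ PPlus U) :
    TukeyLE domLE (UFOrder U) := by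
  unfold PPlus at h
  push Not at h
  obtain ⟨X, hX, hsucc, hno⟩ := h
  have hanti : Antitone X := antitone_nat_of_succ_le hsucc
  refine ⟨fun A n => sInf {k | ∃ s ∈ X n, ↑s ⊆ A.1 ∧ s ⊆ Finset.range k}, fun D hD p => ?_⟩
  have hY : ¬ UPositive U {s | ∃ n, s ∈ X n ∧ s ⊆ Finset.range (p n)} := by
    intro hpos
    obtain ⟨n, hn⟩ := hno _ hpos
    refine hn (((Finset.range n).biUnion fun m => (Finset.range (p m)).powerset).finite_toSet.subset
      ?_)
    rintro s ⟨⟨m, hsm, hsp⟩, hsn⟩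
    have hmn : m < n := by
      by_contra! hnm
      exact hsn (hanti hnm hsm)
    exact Finset.mem_biUnion.2 ⟨m, Finset.mem_range.2 hmn, Finset.mem_powerset.2 hsp⟩
  have hA : ∃ A ∈ U, ∀ n, ∀ s ∈ X n, s ⊆ Finset.range (p n) → ¬ ↑s ⊆ A := by
    by_contra! hall
    refine hY ⟨fun s ⟨n, hs, _⟩ => (hX n).1 s hs, fun A hA => ?_⟩
    obtain ⟨n, s, hs, hsp, hsA⟩ := hall A hA
    exact ⟨s, ⟨n, hs, hsp⟩, (hX n).1 s hs, hsA⟩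
  obtain ⟨A, hA, hAX⟩ := hA
  obtain ⟨B, hBD, hBA⟩ := hD ⟨A, hA⟩
  refine ⟨_, ⟨B, hBD, rfl⟩, fun n => ?_⟩
  obtain ⟨t, htX, -, htB⟩ := (hX n).2 B.1 B.2
  obtain ⟨s, hsX, hsB, hs⟩ := Nat.sInf_mem
    (s := {k | ∃ s ∈ X n, ↑s ⊆ B.1 ∧ s ⊆ Finset.range k})
    ⟨_, t, htX, htB, t.subset_range_sup_succ⟩
  by_contra! hlt
  exact hAX n s hsX (hs.trans (Finset.range_mono hlt.le)) (hsB.trans hBA)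

/-- Theorem: for a nonprincipal ultrafilter `U` on `ω`, `U^{<ω}` is a P⁺-filter
iff `(ω^ω, ≤)` is not Tukey reducible to `(U, ⊇)`. -/
theorem stmt_0 (U : Ultrafilter ℕ) (hU : ∀ a : ℕ, U ≠ pure a) :
    PPlus U ↔ ¬ TukeyLE domLE (UFOrder U) := by
  exact ⟨PPlus.not_tukeyLE hU, fun h => by_contra fun hP => h (tukeyLE_of_not_pPlus hP)⟩
end

section
/- Let U be an ultrafilter on ω and let ⟨X_n : n < ω⟩ be a ⊆-decreasing sequence of U^{<ω}-positive subsets of FIN that has no U^{<ω}-positive pseudo-intersection (i.e. no U^{<ω}-positive X ⊆ FIN with X \ X_n finite for all n). For Z ∈ U define f_Z ∈ ω^ω by f_Z(n) = min{ max(s) : s ∈ [Z]^{<ω} ∩ X_n } (this set is nonempty since X_n is U^{<ω}-positive). Then the map Z ↦ f_Z is monotone from (U,⊇) to (ω^ω,≤) (Z' ⊆ Z implies f_Z ≤ f_{Z'}) and cofinal (for every g ∈ ω^ω there is Y ∈ U with g(n) ≤ f_Y(n) for all n). In particular (ω^ω,≤) ≤_T (U,⊇). -/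
open Set Filter

/-- `f_Z(n) = min { max s : s ∈ [Z]^{<ω} ∩ X_n }` (with `max` of a nonempty
finset computed as `s.sup id`). -/
noncomputable def fZmap (X : ℕ → Set (Finset ℕ)) (Z : Set ℕ) (n : ℕ) : ℕ :=
  sInf {k : ℕ | ∃ s ∈ X n, ↑s ⊆ Z ∧ s.sup id = k}

theorem exists_mem_sup_eq_fZmap {U : Ultrafilter ℕ} {X : ℕ → Set (Finset ℕ)} {n : ℕ}
    (hpos : UPositive U (X n)) {Z : Set ℕ} (hZ : Z ∈ U) :
    ∃ s ∈ X n, ↑s ⊆ Z ∧ s.sup id = fZmap X Z n := by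
  obtain ⟨s, hs, -, hsZ⟩ := hpos.2 Z hZ
  exact Nat.sInf_mem (s := {k : ℕ | ∃ s ∈ X n, ↑s ⊆ Z ∧ s.sup id = k}) ⟨_, s, hs, hsZ, rfl⟩

theorem fZmap_le_of_subset {U : Ultrafilter ℕ} {X : ℕ → Set (Finset ℕ)}
    (hpos : ∀ n, UPositive U (X n)) {Z Z' : Set ℕ} (hZ' : Z' ∈ U) (h : Z' ⊆ Z) :
    domLE (fZmap X Z) (fZmap X Z') := fun n => by
  obtain ⟨s, hs, hsZ, hk⟩ := exists_mem_sup_eq_fZmap (hpos n) hZ'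
  exact Nat.sInf_le ⟨s, hs, hsZ.trans h, hk⟩

theorem finite_setOf_sup_lt (k : ℕ) : {s : Finset ℕ | s.sup id < k}.Finite := by
  refine (Finset.range k).powerset.finite_toSet.subset fun s hs => ?_
  simp only [Finset.mem_coe, Finset.mem_powerset]
  exact fun a ha => Finset.mem_range.2 ((Finset.le_sup (f := id) ha).trans_lt hs)

/-- Gluing the sets `{s ∈ X n : max s < g n}` gives a pseudo-intersection of a decreasing
sequence. -/
theorem finite_glue_diff {X : ℕ → Set (Finset ℕ)} (hdec : Antitone X) (g : ℕ → ℕ) (m : ℕ) :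
    ({s | ∃ n, s ∈ X n ∧ s.sup id < g n} \ X m).Finite := by
  refine ((Set.finite_lt_nat m).biUnion fun n _ => finite_setOf_sup_lt (g n)).subset ?_
  rintro s ⟨⟨n, hs, hlt⟩, hsm⟩
  refine mem_biUnion (x := n) ?_ hlt
  by_contra hn
  exact hsm (hdec (not_lt.1 hn) hs)

theorem exists_le_fZmap {U : Ultrafilter ℕ} {X : ℕ → Set (Finset ℕ)}
    (hpos : ∀ n, UPositive U (X n)) (hdec : Antitone X)
    (hnopi : ¬ ∃ Y : Set (Finset ℕ), UPositive U Y ∧ ∀ n, (Y \ X n).Finite) (g : ℕ → ℕ) :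
    ∃ Y ∈ U, domLE g (fZmap X Y) := by
  by_contra! hg
  refine hnopi ⟨{s | ∃ n, s ∈ X n ∧ s.sup id < g n}, ⟨?_, fun A hA => ?_⟩,
    finite_glue_diff hdec g⟩
  · rintro s ⟨n, hs, -⟩
    exact (hpos n).1 s hs
  · obtain ⟨n, hn⟩ := not_forall.1 (hg A hA)
    obtain ⟨s, hs, hsA, hk⟩ := exists_mem_sup_eq_fZmap (hpos n) hA
    exact ⟨s, ⟨n, hs, hk ▸ not_le.1 hn⟩, (hpos n).1 s hs, hsA⟩

/-- Theorem: if `⟨X_n⟩` is a ⊆-decreasing sequence of `U^{<ω}`-positive sets with no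
`U^{<ω}`-positive pseudo-intersection, then `Z ↦ f_Z` is monotone and cofinal from
`(U, ⊇)` to `(ω^ω, ≤)`; in particular `(ω^ω, ≤) ≤_T (U, ⊇)`. -/
theorem stmt_2 (U : Ultrafilter ℕ) (X : ℕ → Set (Finset ℕ))
    (hpos : ∀ n, UPositive U (X n)) (hdec : ∀ n, X (n + 1) ⊆ X n)
    (hnopi : ¬ ∃ Y : Set (Finset ℕ), UPositive U Y ∧ ∀ n, (Y \ X n).Finite) :
    (∀ Z ∈ U, ∀ Z' ∈ U, Z' ⊆ Z → domLE (fZmap X Z) (fZmap X Z')) ∧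
    (∀ g : ℕ → ℕ, ∃ Y ∈ U, ∀ n, g n ≤ fZmap X Y n) ∧
    TukeyLE domLE (UFOrder U) := by
  have hanti := antitone_nat_of_succ_le hdec
  refine ⟨fun Z _ Z' hZ' h => fZmap_le_of_subset hpos hZ' h, exists_le_fZmap hpos hanti hnopi,
    fun Z => fZmap X Z.1, fun D hD g => ?_⟩
  obtain ⟨Y, hY, hgY⟩ := exists_le_fZmap hpos hanti hnopi g
  obtain ⟨d, hd, hdY⟩ := hD ⟨Y, hY⟩
  exact ⟨_, mem_image_of_mem _ hd,
    fun n => (hgY n).trans (fZmap_le_of_subset hpos d.2 hdY n)⟩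
end

section
/- Let U be an ultrafilter on ω such that U^{<ω} is not a P⁺-filter. Then U is canonically Tukey above (ω^ω,≤*). -/
open Set Filter

/-- `U` is a p-point: nonprincipal, and every countable family from `U`
has a pseudo-intersection in `U`. -/
def IsPPoint (U : Ultrafilter ℕ) : Prop :=
  (∀ a : ℕ, U ≠ pure a) ∧
  ∀ A : ℕ → Set ℕ, (∀ n, A n ∈ U) → ∃ B ∈ U, ∀ n, (B \ A n).Finite

/-- `U` is canonically Tukey above `(ω^ω, ≤*)`, witnessed by a monotone cofinal map
`f : U → ω^ω` and a map `f̂` from finite subsets of `ω` to finite partial functions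
(encoded as `ℕ → Option ℕ`), satisfying conditions (a)-(d). -/
def CanonTukeyAbove (U : Ultrafilter ℕ) : Prop :=
  ∃ (f : Set ℕ → ℕ → ℕ) (fh : Set ℕ → ℕ → Option ℕ),
    -- f̂ sends finite sets to partial functions with finite domain
    (∀ s : Set ℕ, s.Finite → {m : ℕ | (fh s m).isSome}.Finite) ∧
    -- (a) f is monotone from (U, ⊇) to (ω^ω, ≤*) ...
    (∀ A ∈ U, ∀ B ∈ U, B ⊆ A → evDomLE (f A) (f B)) ∧
    -- ... and cofinal
    (∀ g : ℕ → ℕ, ∃ A ∈ U, evDomLE g (f A)) ∧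
    -- (b) f̂ is monotone: domains grow and values decrease
    (∀ s t : Set ℕ, s.Finite → t.Finite → s ⊆ t →
      ∀ x k, fh s x = some k → ∃ l, fh t x = some l ∧ l ≤ k) ∧
    -- (c) domains can be enlarged within any condition ⟨s, A⟩ of Mathias forcing
    (∀ s : Set ℕ, s.Finite → ∀ A ∈ U, (∀ b ∈ s, ∀ a ∈ A, b < a) → ∀ m : ℕ,
      ∃ t : Set ℕ, t.Finite ∧ t ⊆ A ∧ (fh (s ∪ t) m).isSome) ∧
    -- (d) f is determined by f̂ on initial segments, below some X ∈ U
    (∃ X ∈ U, ∀ Y ∈ U, Y ⊆ X → ∀ k : ℕ,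
      f Y k = sInf {v : ℕ | ∃ n : ℕ, fh (Y ∩ Set.Iio n) k = some v})

/-- The least maximum of a member of `X` contained in `A`. -/
noncomputable def minMax (X : Set (Finset ℕ)) (A : Set ℕ) : ℕ :=
  sInf ((fun t : Finset ℕ => t.sup id) '' (X ∩ FinCube A))

theorem FinCube.mono {A B : Set ℕ} (h : A ⊆ B) : FinCube A ⊆ FinCube B :=
  fun _ ht => ⟨ht.1, ht.2.trans h⟩

theorem minMax_le {X : Set (Finset ℕ)} {A : Set ℕ} {t : Finset ℕ} (ht : t ∈ X ∩ FinCube A) :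
    minMax X A ≤ t.sup id :=
  Nat.sInf_le ⟨t, ht, rfl⟩

theorem exists_sup_eq_minMax {X : Set (Finset ℕ)} {A : Set ℕ} (h : (X ∩ FinCube A).Nonempty) :
    ∃ t ∈ X ∩ FinCube A, t.sup id = minMax X A :=
  Nat.sInf_mem (h.image _)

theorem minMax_anti {X : Set (Finset ℕ)} {A B : Set ℕ} (hBA : B ⊆ A)
    (h : (X ∩ FinCube B).Nonempty) : minMax X A ≤ minMax X B := by
  obtain ⟨t, ht, hteq⟩ := exists_sup_eq_minMax h
  exact hteq ▸ minMax_le ⟨ht.1, FinCube.mono hBA ht.2⟩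

theorem finite_setOf_sup_le (N : ℕ) : {t : Finset ℕ | t.sup id ≤ N}.Finite := by
  refine (Finset.finite_toSet (Finset.range (N + 1)).powerset).subset fun t ht => ?_
  simp only [Finset.coe_powerset, mem_preimage, mem_powerset_iff, Finset.coe_subset]
  intro a ha
  exact Finset.mem_range.2 (Nat.lt_succ_of_le ((Finset.le_sup (f := id) ha).trans ht))

/-- If `U^{<ω}` is not a P⁺-filter, then all members of `U` are infinite. -/
theorem infinite_of_not_pPlus {U : Ultrafilter ℕ} (h : ¬ PPlus U) {A : Set ℕ} (hA : A ∈ U) :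
    A.Infinite := by
  intro hfin
  obtain ⟨a, -, rfl⟩ := U.eq_pure_of_finite_mem hfin hA
  refine h fun X hX _ => ⟨{{a}}, ⟨by simp, fun B hB => ⟨{a}, rfl, by simp, ?_⟩⟩, fun n =>
    (finite_singleton _).subset sdiff_subset⟩
  simpa using hB

/-- A decreasing sequence of sets of finite sets without positive pseudo-intersection yields,
for every `g`, a member of `U` on which the least maxima exceed `g`. -/
theorem exists_lt_minMax {U : Ultrafilter ℕ} {X : ℕ → Set (Finset ℕ)}
    (hX : ∀ n, UPositive U (X n)) (hanti : Antitone X)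
    (hno : ¬ ∃ Y : Set (Finset ℕ), UPositive U Y ∧ ∀ n, (Y \ X n).Finite) (g : ℕ → ℕ) :
    ∃ A ∈ U, ∀ n, g n < minMax (X n) A := by
  by_contra! hcon
  refine hno ⟨⋃ n, X n ∩ {t | t.sup id ≤ g n}, ⟨fun s hs => ?_, fun A hA => ?_⟩, fun n => ?_⟩
  · obtain ⟨n, hn, -⟩ := mem_iUnion.1 hs
    exact (hX n).1 s hn
  · obtain ⟨n, hn⟩ := hcon A hA
    obtain ⟨t, ht, hteq⟩ := exists_sup_eq_minMax ((hX n).2 A hA)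
    exact ⟨t, mem_iUnion.2 ⟨n, ht.1, hteq.trans_le hn⟩, ht.2⟩
  · refine ((finite_Iio n).biUnion fun m _ => finite_setOf_sup_le (g m)).subset ?_
    rintro t ⟨ht, htn⟩
    obtain ⟨m, hm, hle⟩ := mem_iUnion.1 ht
    exact mem_biUnion (show m < n from not_le.1 fun hnm => htn (hanti hnm hm)) hle

open Classical in
/-- The finite partial function approximating `fun k => minMax (X k) A` on finite `s ⊆ A`. -/
noncomputable def minMaxApprox (X : ℕ → Set (Finset ℕ)) (s : Set ℕ) (k : ℕ) : Option ℕ :=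
  if k < s.ncard ∧ (X k ∩ FinCube s).Nonempty then some (minMax (X k) s) else none

theorem minMaxApprox_eq_some {X : ℕ → Set (Finset ℕ)} {s : Set ℕ} {k v : ℕ} :
    minMaxApprox X s k = some v ↔
      (k < s.ncard ∧ (X k ∩ FinCube s).Nonempty) ∧ minMax (X k) s = v := by
  simp [minMaxApprox]

theorem finite_minMaxApprox_isSome (X : ℕ → Set (Finset ℕ)) (s : Set ℕ) :
    {k | (minMaxApprox X s k).isSome}.Finite := by
  refine (finite_Iio s.ncard).subset fun k hk => ?_
  obtain ⟨v, hv⟩ := Option.isSome_iff_exists.1 hk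
  exact (minMaxApprox_eq_some.1 hv).1.1

theorem minMaxApprox_mono {X : ℕ → Set (Finset ℕ)} {s t : Set ℕ} (ht : t.Finite) (hst : s ⊆ t)
    {k v : ℕ} (h : minMaxApprox X s k = some v) : ∃ w, minMaxApprox X t k = some w ∧ w ≤ v := by
  obtain ⟨⟨hk, hne⟩, rfl⟩ := minMaxApprox_eq_some.1 h
  exact ⟨_, minMaxApprox_eq_some.2 ⟨⟨hk.trans_le (ncard_le_ncard hst ht),
    hne.mono (inter_subset_inter_right _ (FinCube.mono hst))⟩, rfl⟩, minMax_anti hst hne⟩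

/-- Every finite set in `X k` below an infinite `A` lies in a finite subset of `A` on which the
approximation is defined at `k`. -/
theorem exists_finite_minMaxApprox {X : ℕ → Set (Finset ℕ)} {A : Set ℕ} (hA : A.Infinite)
    {k : ℕ} {u : Finset ℕ} (hu : u ∈ X k ∩ FinCube A) :
    ∃ t : Finset ℕ, ↑t ⊆ A ∧ ∃ v ≤ u.sup id, minMaxApprox X t k = some v := by
  obtain ⟨w, hw, hcard⟩ := hA.exists_subset_card_eq (k + 1)
  have hut : u ∈ X k ∩ FinCube (↑(u ∪ w) : Set ℕ) :=
    ⟨hu.1, hu.2.1, by exact_mod_cast Finset.subset_union_left⟩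
  refine ⟨u ∪ w, by simpa using ⟨hu.2.2, hw⟩, _, minMax_le hut,
    minMaxApprox_eq_some.2 ⟨⟨?_, u, hut⟩, rfl⟩⟩
  rw [ncard_coe_finset]
  have := Finset.card_le_card (Finset.subset_union_right (s₁ := u) (s₂ := w))
  omega

theorem minMax_eq_sInf_minMaxApprox {X : ℕ → Set (Finset ℕ)} {Y : Set ℕ} (hY : Y.Infinite)
    {k : ℕ} (hne : (X k ∩ FinCube Y).Nonempty) :
    minMax (X k) Y = sInf {v | ∃ n, minMaxApprox X (Y ∩ Iio n) k = some v} := by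
  obtain ⟨u, hu, hueq⟩ := exists_sup_eq_minMax hne
  obtain ⟨t, htY, v, hv, htv⟩ := exists_finite_minMaxApprox hY hu
  have hsub : (t : Set ℕ) ⊆ Y ∩ Iio (t.sup id + 1) := fun a ha =>
    ⟨htY ha, Nat.lt_succ_of_le (Finset.le_sup (f := id) ha)⟩
  obtain ⟨w, hw, hwv⟩ := minMaxApprox_mono ((finite_Iio _).inter_of_right _) hsub htv
  refine le_antisymm (le_csInf ⟨w, t.sup id + 1, hw⟩ ?_)
    (le_trans (Nat.sInf_le ⟨t.sup id + 1, hw⟩) ?_)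
  · rintro x ⟨n, hn⟩
    obtain ⟨⟨-, hn'⟩, rfl⟩ := minMaxApprox_eq_some.1 hn
    exact minMax_anti inter_subset_left hn'
  · exact hueq ▸ hwv.trans hv

/-- Theorem: if `U^{<ω}` is not a P⁺-filter, then `U` is canonically
Tukey above `(ω^ω, ≤*)`. -/
theorem stmt_4 (U : Ultrafilter ℕ) (h : ¬ PPlus U) : CanonTukeyAbove U := by
  have hinf : ∀ A ∈ U, A.Infinite := fun A hA => infinite_of_not_pPlus h hA
  unfold PPlus at h
  push Not at h
  obtain ⟨X, hX, hdec, hno⟩ := h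
  have hno' : ¬ ∃ Y : Set (Finset ℕ), UPositive U Y ∧ ∀ n, (Y \ X n).Finite := by
    rintro ⟨Y, hY, hfin⟩
    obtain ⟨n, hn⟩ := hno Y hY
    exact hn (hfin n)
  refine ⟨fun A k => minMax (X k) A, minMaxApprox X, fun s _ => finite_minMaxApprox_isSome X s,
    fun A _ B hB hBA => .of_forall fun k => minMax_anti hBA ((hX k).2 B hB), fun g => ?_,
    fun s t _ ht hst x k hk => minMaxApprox_mono ht hst hk, fun s hs A hA _ m => ?_,
    univ, univ_mem, fun Y hY _ k => minMax_eq_sInf_minMaxApprox (hinf Y hY) ((hX k).2 Y hY)⟩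
  · obtain ⟨A, hA, hg⟩ := exists_lt_minMax hX (antitone_nat_of_succ_le hdec) hno' g
    exact ⟨A, hA, .of_forall fun n => (hg n).le⟩
  · obtain ⟨u, hu⟩ := (hX m).2 A hA
    obtain ⟨t, htA, v, -, hv⟩ := exists_finite_minMaxApprox (hinf A hA) hu
    obtain ⟨w, hw, -⟩ := minMaxApprox_mono (hs.union t.finite_toSet) subset_union_right hv
    exact ⟨t, t.finite_toSet, htA, Option.isSome_iff_exists.2 ⟨w, hw⟩⟩
end

section
/- For any ultrafilter U on ω, the following are equivalent: (i) U^{<ω} is not a P⁺-filter; (ii) U is canonically Tukey above (ω^ω,≤*). -/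
open Set Filter

theorem Ultrafilter.compl_mem_of_finite_of_ne_pure {U : Ultrafilter ℕ} (hU : ∀ a, U ≠ pure a)
    {F : Set ℕ} (hF : F.Finite) : Fᶜ ∈ U := by
  rw [Ultrafilter.compl_mem_iff_notMem]
  intro h
  obtain ⟨a, -, ha⟩ := Ultrafilter.eq_pure_of_finite_mem hF h
  exact hU a ha

theorem pPlus_pure (a : ℕ) : PPlus (pure a) := by
  intro X hX _
  have singleton_mem : ∀ n, {a} ∈ X n := by
    intro n
    obtain ⟨s, hs, hne, hsub⟩ := (hX n).2 {a} (Ultrafilter.mem_pure.2 rfl)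
    have : s = {a} := by
      rcases Finset.subset_singleton_iff.1 (by exact_mod_cast hsub) with h | h
      · exact absurd h hne.ne_empty
      · exact h
    exact this ▸ hs
  refine ⟨{{a}}, ⟨by rintro s rfl; exact Finset.singleton_nonempty a, fun A hA => ?_⟩, fun n => ?_⟩
  · exact ⟨{a}, rfl, Finset.singleton_nonempty a, by simpa using Ultrafilter.mem_pure.1 hA⟩
  · exact (Set.finite_singleton _).subset Set.sdiff_subset

/-- Codes of the members of `X` that are contained in `s`. -/
def subsetCodes (X : Set (Finset ℕ)) (s : Set ℕ) : Set ℕ :=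
  {v | ∃ t ∈ X, ↑t ⊆ s ∧ Encodable.encode t = v}

theorem subsetCodes_mono (X : Set (Finset ℕ)) {s t : Set ℕ} (h : s ⊆ t) :
    subsetCodes X s ⊆ subsetCodes X t := by
  rintro v ⟨u, hu, hs, rfl⟩
  exact ⟨u, hu, hs.trans h, rfl⟩

theorem UPositive.subsetCodes_nonempty {U : Ultrafilter ℕ} {X : Set (Finset ℕ)}
    (hX : UPositive U X) {A : Set ℕ} (hA : A ∈ U) : (subsetCodes X A).Nonempty := by
  obtain ⟨t, ht, -, hsub⟩ := hX.2 A hA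
  exact ⟨_, t, ht, hsub, rfl⟩

open scoped Classical in
/-- The least code of a member of `X k` contained in `s`, provided one exists and `s` has an
element that is at least `k`. -/
noncomputable def leastCode (X : ℕ → Set (Finset ℕ)) (s : Set ℕ) (k : ℕ) : Option ℕ :=
  if (∃ x ∈ s, k ≤ x) ∧ (subsetCodes (X k) s).Nonempty then some (sInf (subsetCodes (X k) s))
  else none

theorem leastCode_eq_some {X : ℕ → Set (Finset ℕ)} {s : Set ℕ} {k v : ℕ} :
    leastCode X s k = some v ↔
      ((∃ x ∈ s, k ≤ x) ∧ (subsetCodes (X k) s).Nonempty) ∧ sInf (subsetCodes (X k) s) = v := by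
  simp [leastCode]

theorem leastCode_isSome {X : ℕ → Set (Finset ℕ)} {s : Set ℕ} {k : ℕ} :
    (leastCode X s k).isSome ↔ (∃ x ∈ s, k ≤ x) ∧ (subsetCodes (X k) s).Nonempty := by
  simp [leastCode]

theorem exists_evDomLE_sInf_subsetCodes {U : Ultrafilter ℕ} {X : ℕ → Set (Finset ℕ)}
    (hX : ∀ n, UPositive U (X n)) (hdec : ∀ n, X (n + 1) ⊆ X n)
    (hno : ¬ ∃ Y, UPositive U Y ∧ ∀ n, (Y \ X n).Finite) (g : ℕ → ℕ) :
    ∃ A ∈ U, evDomLE g fun k => sInf (subsetCodes (X k) A) := by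
  by_contra! hg
  refine hno ⟨{t | ∃ k, t ∈ X k ∧ Encodable.encode t < g k}, ⟨?_, fun A hA => ?_⟩, fun n => ?_⟩
  · rintro t ⟨k, ht, -⟩
    exact (hX k).1 t ht
  · have h := hg A hA
    rw [evDomLE, Filter.not_eventually] at h
    obtain ⟨k, hk⟩ := h.exists
    obtain ⟨t, ht, hsub, he⟩ := Nat.sInf_mem ((hX k).subsetCodes_nonempty hA)
    exact ⟨t, ⟨k, ht, by omega⟩, (hX k).1 t ht, hsub⟩
  · have hfin : (⋃ k ∈ Set.Iio n, {t : Finset ℕ | Encodable.encode t < g k}).Finite :=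
      (Set.finite_Iio n).biUnion fun k _ =>
        (Set.finite_Iio (g k)).preimage Encodable.encode_injective.injOn
    refine hfin.subset ?_
    rintro t ⟨⟨k, ht, hlt⟩, hn⟩
    have hkn : k < n := by
      by_contra! hle
      exact hn (antitone_nat_of_succ_le hdec hle ht)
    exact Set.mem_biUnion (Set.mem_Iio.2 hkn) hlt

theorem canonTukeyAbove_of_not_pPlus {U : Ultrafilter ℕ} (h : ¬ PPlus U) :
    CanonTukeyAbove U := by
  have hU : ∀ a, U ≠ pure a := by
    rintro a rfl
    exact h (pPlus_pure a)
  have unbounded : ∀ A ∈ U, ∀ k, ∃ x ∈ A, k ≤ x := by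
    intro A hA k
    obtain ⟨x, hx, hk⟩ := U.nonempty_of_mem
      (inter_mem hA (U.compl_mem_of_finite_of_ne_pure hU (Set.finite_Iio k)))
    exact ⟨x, hx, by simpa using hk⟩
  unfold PPlus at h
  push Not at h
  obtain ⟨X, hX, hdec, hno⟩ := h
  refine ⟨fun A k => sInf (subsetCodes (X k) A), leastCode X, ?_, ?_, ?_, ?_, ?_, ?_⟩
  · intro s hs
    obtain ⟨b, hb⟩ := hs.bddAbove
    refine (Set.finite_Iic b).subset fun m hm => ?_
    obtain ⟨⟨x, hx, hmx⟩, -⟩ := leastCode_isSome.1 hm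
    exact hmx.trans (hb hx)
  · intro A _ B hB hBA
    exact Filter.Eventually.of_forall fun k => Nat.sInf_le <|
      subsetCodes_mono _ hBA (Nat.sInf_mem ((hX k).subsetCodes_nonempty hB))
  · refine exists_evDomLE_sInf_subsetCodes hX hdec ?_
    rintro ⟨Y, hY, hfin⟩
    obtain ⟨n, hn⟩ := hno Y hY
    exact hn (hfin n)
  · intro s t _ _ hst x k hk
    obtain ⟨⟨⟨y, hy, hxy⟩, hne⟩, rfl⟩ := leastCode_eq_some.1 hk
    exact ⟨_, leastCode_eq_some.2 ⟨⟨⟨y, hst hy, hxy⟩, hne.mono (subsetCodes_mono _ hst)⟩, rfl⟩,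
      Nat.sInf_le (subsetCodes_mono _ hst (Nat.sInf_mem hne))⟩
  · intro s _ A hA _ m
    obtain ⟨x, hx, hmx⟩ := unbounded A hA m
    obtain ⟨t, ht, -, hsub⟩ := (hX m).2 A hA
    refine ⟨insert x ↑t, t.finite_toSet.insert x, Set.insert_subset hx hsub, ?_⟩
    exact leastCode_isSome.2 ⟨⟨x, by simp, hmx⟩, _, t, ht,
      (Set.subset_insert _ _).trans Set.subset_union_right, rfl⟩
  · refine ⟨Set.univ, univ_mem, fun Y hY _ k => ?_⟩
    obtain ⟨x, hx, hkx⟩ := unbounded Y hY k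
    obtain ⟨t, ht, hsub, he⟩ := Nat.sInf_mem ((hX k).subsetCodes_nonempty hY)
    obtain ⟨b, hb⟩ := t.finite_toSet.bddAbove
    have hmem : Encodable.encode t ∈ subsetCodes (X k) (Y ∩ Set.Iio (max x b + 1)) :=
      ⟨t, ht, fun y hy => ⟨hsub hy, by have := hb hy; simp only [Set.mem_Iio]; omega⟩, rfl⟩
    have hsome : leastCode X (Y ∩ Set.Iio (max x b + 1)) k =
        some (sInf (subsetCodes (X k) (Y ∩ Set.Iio (max x b + 1)))) :=
      leastCode_eq_some.2
        ⟨⟨⟨x, ⟨hx, by simp only [Set.mem_Iio]; omega⟩, hkx⟩, _, hmem⟩, rfl⟩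
    have hvalue : sInf (subsetCodes (X k) (Y ∩ Set.Iio (max x b + 1))) ∈
        {v | ∃ n, leastCode X (Y ∩ Set.Iio n) k = some v} := ⟨_, hsome⟩
    apply le_antisymm
    · obtain ⟨n, hn⟩ := Nat.sInf_mem ⟨_, hvalue⟩
      obtain ⟨⟨-, hne⟩, hv⟩ := leastCode_eq_some.1 hn
      rw [← hv]
      exact Nat.sInf_le (subsetCodes_mono _ Set.inter_subset_left (Nat.sInf_mem hne))
    · exact (Nat.sInf_le hvalue).trans ((Nat.sInf_le hmem).trans he.le)

theorem UPositive.exists_mem_of_finite_diff {U : Ultrafilter ℕ} (hU : ∀ a, U ≠ pure a)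
    {X Y : Set (Finset ℕ)} (hY : UPositive U Y) (hfin : (Y \ X).Finite) {A : Set ℕ}
    (hA : A ∈ U) : ∃ s ∈ Y, s ∈ X ∧ ↑s ⊆ A := by
  have hF : (⋃ s ∈ Y \ X, (s : Set ℕ)).Finite := hfin.biUnion fun s _ => s.finite_toSet
  obtain ⟨s, hs, ⟨x, hx⟩, hsub⟩ :=
    hY.2 _ (inter_mem hA (U.compl_mem_of_finite_of_ne_pure hU hF))
  refine ⟨s, hs, ?_, hsub.trans Set.inter_subset_left⟩
  by_contra hsX
  exact (hsub hx).2 (Set.mem_biUnion (⟨hs, hsX⟩ : s ∈ Y \ X) hx)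

theorem not_pPlus_of_canonTukeyAbove {U : Ultrafilter ℕ} (h : CanonTukeyAbove U) :
    ¬ PPlus U := by
  obtain ⟨f, fh, hdom, hmono, hcof, hfh, hext, Z, hZ, hf⟩ := h
  intro hP
  have hU : ∀ a, U ≠ pure a := by
    rintro a rfl
    obtain ⟨A, hA, hgA⟩ := hcof fun n => f {a} n + 1
    have hle := hmono A hA {a} (Ultrafilter.mem_pure.2 rfl)
      (Set.singleton_subset_iff.2 (Ultrafilter.mem_pure.1 hA))
    obtain ⟨n, h₁, h₂⟩ := (hgA.and hle).exists
    exact absurd (h₁.trans h₂) (Nat.not_succ_le_self _)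
  let X : ℕ → Set (Finset ℕ) := fun n => {s | s.Nonempty ∧ ∃ k ≥ n, (fh ↑s k).isSome}
  have hX : ∀ n, UPositive U (X n) := by
    refine fun n => ⟨fun s hs => hs.1, fun A hA => ?_⟩
    obtain ⟨a, ha⟩ := U.nonempty_of_mem hA
    obtain ⟨t, htfin, htA, ht⟩ := hext ∅ Set.finite_empty A hA (by simp) n
    rw [Set.empty_union] at ht
    obtain ⟨v, hv⟩ := Option.isSome_iff_exists.1 ht
    obtain ⟨l, hl, -⟩ := hfh t (insert a t) htfin (htfin.insert a) (Set.subset_insert a t) n v hv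
    have hcoe : ((htfin.insert a).toFinset : Set ℕ) = insert a t := Set.Finite.coe_toFinset _
    have hne : (htfin.insert a).toFinset.Nonempty := ⟨a, by simp⟩
    refine ⟨(htfin.insert a).toFinset, ⟨hne, n, le_rfl, ?_⟩, hne, ?_⟩
    · rw [hcoe, hl]; rfl
    · rw [hcoe]; exact Set.insert_subset ha htA
  obtain ⟨Y, hY, hfin⟩ := hP X hX fun n s ⟨hs, k, hk, hsome⟩ => ⟨hs, k, by omega, hsome⟩
  have hbound : ∀ k, ∃ b, ∀ s ∈ Y \ X (k + 1), ∀ v, fh ↑s k = some v → v < b := by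
    intro k
    obtain ⟨b, hb⟩ := ((hfin (k + 1)).image fun s : Finset ℕ => (fh ↑s k).getD 0).bddAbove
    refine ⟨b + 1, fun s hs v hv => Nat.lt_succ_of_le (hb ⟨s, hs, ?_⟩)⟩
    simp [hv]
  choose g hg using hbound
  obtain ⟨A, hA, hgA⟩ := hcof g
  have hAZ : A ∩ Z ∈ U := inter_mem hA hZ
  obtain ⟨N, hN⟩ := Filter.eventually_atTop.1
    (hgA.and (hmono A hA (A ∩ Z) hAZ Set.inter_subset_left))
  obtain ⟨s, hsY, ⟨hne, k, hk, hsome⟩, hsub⟩ := hY.exists_mem_of_finite_diff hU (hfin N) hAZ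
  have hsfin := hdom ↑s s.finite_toSet
  obtain ⟨m, hm, hmax⟩ := hsfin.exists_maximalFor id _ ⟨k, hsome⟩
  have hmax' : ∀ j, (fh ↑s j).isSome → j ≤ m := fun j hj => by
    rcases le_total m j with h | h
    · exact hmax hj h
    · exact h
  obtain ⟨v, hv⟩ := Option.isSome_iff_exists.1 hm
  have hvg : v < g m := by
    refine hg m s ⟨hsY, ?_⟩ v hv
    rintro ⟨-, j, hj, hjs⟩
    have := hmax' j hjs
    omega
  obtain ⟨b, hb⟩ := s.finite_toSet.bddAbove
  obtain ⟨l, hl, hlv⟩ := hfh ↑s (A ∩ Z ∩ Set.Iio (b + 1)) s.finite_toSet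
    ((Set.finite_Iio _).subset Set.inter_subset_right)
    (fun x hx => ⟨hsub hx, Nat.lt_succ_of_le (hb hx)⟩) m v hv
  have hfl : f (A ∩ Z) m ≤ l := by
    rw [hf _ hAZ Set.inter_subset_right m]
    exact Nat.sInf_le ⟨_, hl⟩
  obtain ⟨h₁, h₂⟩ := hN m (hk.trans (hmax' k hsome))
  omega

/-- Theorem: `U^{<ω}` is not a P⁺-filter iff `U` is canonically
Tukey above `(ω^ω, ≤*)`. -/
theorem stmt_5 (U : Ultrafilter ℕ) :
    ¬ PPlus U ↔ CanonTukeyAbove U :=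
  ⟨canonTukeyAbove_of_not_pPlus, not_pPlus_of_canonTukeyAbove⟩
end

section
/- Let U be an ultrafilter on ω. If (ω^ω,≤) is Tukey reducible to (U,⊇), then U^{<ω} is not a P⁺-filter. -/
open Set Filter

/-- The sets of a P⁺ ultrafilter satisfy the P-point property. -/
theorem PPlus.exists_pseudoIntersection_s6 {U : Ultrafilter ℕ} (hP : PPlus U)
    (B : ℕ → Set ℕ) (hB : ∀ n, B n ∈ U) :
    ∃ P ∈ U, ∀ n, ∃ N, ∀ x ∈ P, N ≤ x → x ∈ B n := by
  have hC : ∀ n, {x | ∀ i ≤ n, x ∈ B i} ∈ U := by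
    intro n
    have := (Filter.biInter_mem (f := (U : Filter ℕ)) (s := B) (Set.finite_Iic n)).2
      (fun i _ => hB i)
    refine Filter.mem_of_superset this ?_
    intro x hx i hi
    exact Set.mem_iInter₂.1 hx i hi
  obtain ⟨Y, ⟨-, hY⟩, hfin⟩ := hP (fun n => FinCube {x | ∀ i ≤ n, x ∈ B i})
    (fun n => ⟨fun s hs => hs.1, fun A hA => by
      obtain ⟨x, hx⟩ := U.nonempty_of_mem (Filter.inter_mem (hC n) hA)
      exact ⟨{x}, ⟨by simp, by simpa using hx.1⟩, ⟨by simp, by simpa using hx.2⟩⟩⟩)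
    (fun n s hs => ⟨hs.1, fun x hx i hi => hs.2 hx i (by omega)⟩)
  refine ⟨{x | ∃ s ∈ Y, x ∈ s}, ?_, fun n => ?_⟩
  · by_contra hU
    obtain ⟨s, hs, ⟨x, hx⟩, hsA⟩ := hY _ (Ultrafilter.compl_mem_iff_notMem.2 hU)
    exact hsA hx ⟨s, hs, hx⟩
  · refine ⟨((hfin n).toFinset.sup fun s => s.sup id) + 1, ?_⟩
    rintro x ⟨s, hs, hx⟩ hN
    by_contra hxB
    have hsn : s ∈ (hfin n).toFinset := by
      rw [Set.Finite.mem_toFinset]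
      exact ⟨hs, fun h => hxB (h.2 hx n le_rfl)⟩
    have h1 : x ≤ s.sup id := Finset.le_sup (f := id) hx
    have h2 := Finset.le_sup (f := fun s : Finset ℕ => s.sup id) hsn
    omega

/-- Every member of a P⁺ ultrafilter can be shrunk so that, for infinitely many `n`, its part
above `n` lies in the `n`-th of a given sequence of members. -/
theorem PPlus.exists_tail_subset {U : Ultrafilter ℕ} (hP : PPlus U)
    (B : ℕ → Set ℕ) (hB : ∀ n, B n ∈ U) {A : Set ℕ} (hA : A ∈ U) :
    ∃ X ∈ U, X ⊆ A ∧ ∀ N, ∃ n ≥ N, ∀ x ∈ X, n ≤ x → x ∈ B n := by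
  obtain ⟨P, hPU, hPB⟩ := hP.exists_pseudoIntersection_s6 B hB
  choose g hg using hPB
  let e : ℕ → ℕ := fun i => Nat.rec 0 (fun _ y => max (y + 1) (g y)) i
  have he : ∀ i, e (i + 1) = max (e i + 1) (g (e i)) := fun i => rfl
  have hmono : StrictMono e := strictMono_nat_of_lt_succ fun i => by
    rw [he]; exact lt_of_lt_of_le (Nat.lt_succ_self _) (le_max_left _ _)
  have hge : ∀ i, g (e i) ≤ e (i + 1) := fun i => by rw [he]; exact le_max_right _ _
  let E : Set ℕ := {x | ∃ i, e (2 * i) ≤ x ∧ x < e (2 * i + 1)}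
  rcases U.mem_or_compl_mem E with hE | hE
  · refine ⟨A ∩ P ∩ E, Filter.inter_mem (Filter.inter_mem hA hPU) hE,
      fun x hx => hx.1.1, fun N => ⟨e (2 * N + 1), ?_, ?_⟩⟩
    · have := hmono.le_apply (x := 2 * N + 1)
      omega
    · rintro x ⟨⟨-, hxP⟩, i, hi, hi'⟩ hx
      have h1 : 2 * N + 1 < 2 * i + 1 := hmono.lt_iff_lt.1 (hx.trans_lt hi')
      have h2 : e (2 * N + 1 + 1) ≤ e (2 * i) :=
        hmono.monotone (show 2 * N + 1 + 1 ≤ 2 * i by omega)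
      exact hg _ x hxP ((hge (2 * N + 1)).trans (h2.trans hi))
  · refine ⟨A ∩ P ∩ Eᶜ, Filter.inter_mem (Filter.inter_mem hA hPU) hE,
      fun x hx => hx.1.1, fun N => ⟨e (2 * N), ?_, ?_⟩⟩
    · have := hmono.le_apply (x := 2 * N)
      omega
    · rintro x ⟨⟨-, hxP⟩, hxE⟩ hx
      refine hg _ x hxP ((hge (2 * N)).trans ?_)
      by_contra hlt
      exact hxE ⟨N, hx, not_le.1 hlt⟩

/-- A Tukey reduction of `r` to `r'` yields a map in the other direction together with bounds. -/
theorem TukeyLE.exists_dual {α β : Type*} {rQ : β → β → Prop} {rP : α → α → Prop}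
    (h : TukeyLE rQ rP) :
    ∃ (f : α → β) (g : β → α), ∀ q p, rP (g q) p → rQ q (f p) := by
  obtain ⟨f, hf⟩ := h
  have key : ∀ q, ∃ p₀, ∀ p, rP p₀ p → rQ q (f p) := by
    intro q
    by_contra! hq
    obtain ⟨_, ⟨p, hp, rfl⟩, hqp⟩ := hf {p | ¬ rQ q (f p)} (fun p₀ => by
      obtain ⟨p, hp, hp'⟩ := hq p₀
      exact ⟨p, hp', hp⟩) q
    exact hp hqp
  choose g hg using key
  exact ⟨f, g, hg⟩

/-- `M` bounds the values at `k` of all functions `h` with `A ⊆ G h`. -/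
def ValueBound (G : (ℕ → ℕ) → Set ℕ) (A : Set ℕ) (k M : ℕ) : Prop :=
  ∀ h, A ⊆ G h → h k ≤ M

theorem ValueBound.mono {G : (ℕ → ℕ) → Set ℕ} {A A' : Set ℕ} {k M : ℕ}
    (h : ValueBound G A k M) (hA : A ⊆ A') : ValueBound G A' k M :=
  fun f hf => h f (hA.trans hf)

/-- The finite set `s` alone determines a bound, valid for all `s ∪ B` with `B ∈ U`. -/
def DecidesBound (U : Ultrafilter ℕ) (G : (ℕ → ℕ) → Set ℕ) (s : Finset ℕ) (k : ℕ) : Prop :=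
  ∃ M, ∀ B ∈ U, ValueBound G (↑s ∪ B) k M

theorem exists_not_subset_of_not_decidesBound {U : Ultrafilter ℕ} {G : (ℕ → ℕ) → Set ℕ}
    (hbdd : ∀ A ∈ U, ∀ k, ∃ M, ValueBound G A k M) {s : Finset ℕ} (hs : s.Nonempty) {k : ℕ}
    (hd : ¬ DecidesBound U G s k) : ∃ A ∈ U, ¬ (↑s ⊆ A) := by
  by_contra! hall
  obtain ⟨x, hx⟩ := hs
  have hxU : {x} ∈ U := by
    by_contra hxU
    exact hall _ (Ultrafilter.compl_mem_iff_notMem.2 hxU) hx rfl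
  obtain ⟨M, hM⟩ := hbdd _ hxU k
  exact hd ⟨M, fun B _ => hM.mono (by simpa using Or.inl hx)⟩

theorem PPlus.uPositive_decidesBound {U : Ultrafilter ℕ} (hP : PPlus U)
    {G : (ℕ → ℕ) → Set ℕ} (hbdd : ∀ A ∈ U, ∀ k, ∃ M, ValueBound G A k M) (K : ℕ) :
    UPositive U {s | s.Nonempty ∧ ∀ k ≤ K, DecidesBound U G s k} := by
  refine ⟨fun s hs => hs.1, fun A hA => ?_⟩
  have hex : ∀ (s : Finset ℕ) (k m : ℕ), ∃ B ∈ U,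
      ValueBound G (↑s ∪ B) k m → ∀ B' ∈ U, ValueBound G (↑s ∪ B') k m := by
    intro s k m
    by_cases h : ∀ B' ∈ U, ValueBound G (↑s ∪ B') k m
    · exact ⟨univ, Filter.univ_mem, fun _ => h⟩
    · push Not at h
      obtain ⟨B, hB, hB'⟩ := h
      exact ⟨B, hB, fun h' => absurd h' hB'⟩
  choose B hBU hB using hex
  let C : ℕ → Set ℕ := fun n =>
    ⋂ t ∈ (Finset.range n).powerset ×ˢ (Finset.range n ×ˢ Finset.range n), B t.1 t.2.1 t.2.2
  have hC : ∀ n, C n ∈ U := fun n =>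
    (Filter.biInter_finset_mem (f := (U : Filter ℕ)) _).2 fun t _ => hBU _ _ _
  obtain ⟨X, hXU, hXA, hX⟩ := hP.exists_tail_subset C hC hA
  obtain ⟨x, hx⟩ := U.nonempty_of_mem hXU
  choose M hM using hbdd X hXU
  obtain ⟨n, hn, htail⟩ := hX (x + K + (Finset.range (K + 1)).sup M + 1)
  classical
  refine ⟨{y ∈ Finset.range n | y ∈ X}, ⟨⟨x, ?_⟩, fun k hk => ⟨M k, ?_⟩⟩, ⟨x, ?_⟩, ?_⟩
  · simp only [Finset.mem_filter, Finset.mem_range]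
    exact ⟨by omega, hx⟩
  · refine hB _ _ _ ((hM k).mono fun y hy => ?_)
    by_cases hyn : y < n
    · left
      simp [hyn, hy]
    · right
      have hMk : M k ≤ (Finset.range (K + 1)).sup M :=
        Finset.le_sup (Finset.mem_range.2 (by omega))
      refine Set.mem_iInter₂.1 (htail y hy (not_lt.1 hyn))
        ({y ∈ Finset.range n | y ∈ X}, k, M k) ?_
      simp only [Finset.mem_product, Finset.mem_powerset, Finset.mem_range]
      exact ⟨Finset.filter_subset _ _, by omega, by omega⟩
  · simp only [Finset.mem_filter, Finset.mem_range]
    exact ⟨by omega, hx⟩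
  · intro y hy
    simp only [Finset.coe_filter, Set.mem_ofPred_eq] at hy
    exact hXA hy.2

/-- A positive pseudo-intersection of a decreasing sequence admits a labelling which is
finite-to-one and compatible with the sequence. -/
theorem exists_finite_to_one_label {Y : Set (Finset ℕ)} {X : ℕ → Set (Finset ℕ)}
    (hY : ∀ n, (Y \ X n).Finite) :
    ∃ l : Finset ℕ → ℕ, (∀ s ∈ X 0, s ∈ X (l s)) ∧ ∀ k, {s ∈ Y | l s = k}.Finite := by
  classical
  refine ⟨fun s => Nat.findGreatest (fun k => s ∈ X k) (Encodable.encode s), ?_, fun k => ?_⟩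
  · intro s hs
    exact Nat.findGreatest_spec (P := fun k => s ∈ X k) (Nat.zero_le _) hs
  · have hfin : {s : Finset ℕ | Encodable.encode s ≤ k}.Finite :=
      (Set.finite_Iic k).preimage Encodable.encode_injective.injOn
    refine (hfin.union (hY (k + 1))).subset ?_
    rintro s ⟨hs, hl⟩
    by_cases hk : Encodable.encode s ≤ k
    · exact Or.inl hk
    · refine Or.inr ⟨hs, fun hX => ?_⟩
      have := Nat.le_findGreatest (P := fun k => s ∈ X k) (not_le.1 hk) hX
      simp only at hl
      omega

/-- Theorem: if `(ω^ω, ≤)` is Tukey reducible to `(U, ⊇)`, then `U^{<ω}` is not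
a P⁺-filter. -/
theorem stmt_6 (U : Ultrafilter ℕ) (h : TukeyLE domLE (UFOrder U)) : ¬ PPlus U := by
  intro hP
  obtain ⟨f, g, hfg⟩ := h.exists_dual
  have hbdd : ∀ A ∈ U, ∀ k, ∃ M, ValueBound (fun h => (g h).1) A k M :=
    fun A hA k => ⟨f ⟨A, hA⟩ k, fun h hAh => hfg h ⟨A, hA⟩ hAh k⟩
  obtain ⟨Y, ⟨hYne, hYpos⟩, hYfin⟩ := hP
    (fun K => {s | s.Nonempty ∧ ∀ k ≤ K, DecidesBound U (fun h => (g h).1) s k})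
    (hP.uPositive_decidesBound hbdd)
    (fun n s hs => ⟨hs.1, fun k hk => hs.2 k (by omega)⟩)
  obtain ⟨l, hl, hlfin⟩ := exists_finite_to_one_label hYfin
  have hM : ∀ s k, ∃ M, DecidesBound U (fun h => (g h).1) s k →
      ∀ B ∈ U, ValueBound (fun h => (g h).1) (↑s ∪ B) k M := by
    intro s k
    by_cases hd : DecidesBound U (fun h => (g h).1) s k
    · obtain ⟨M, hM⟩ := hd
      exact ⟨M, fun _ => hM⟩
    · exact ⟨0, fun h => absurd h hd⟩
  choose M hM using hM
  have havoid : ∀ s, ∃ A ∈ U, s.Nonempty → ¬ DecidesBound U (fun h => (g h).1) s 0 →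
      ¬ (↑s ⊆ A) := by
    intro s
    by_cases hs : s.Nonempty ∧ ¬ DecidesBound U (fun h => (g h).1) s 0
    · obtain ⟨A, hA, hsA⟩ := exists_not_subset_of_not_decidesBound hbdd hs.1 hs.2
      exact ⟨A, hA, fun _ _ => hsA⟩
    · exact ⟨univ, Filter.univ_mem, fun h1 h2 => absurd ⟨h1, h2⟩ hs⟩
  choose V hVU hV using havoid
  let ψ : ℕ → ℕ := fun k => (hlfin k).toFinset.sup (fun s => M s k) + 1
  have hAU : (g ψ).1 ∩ ⋂ s ∈ Y \ {s | s.Nonempty ∧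
      ∀ k ≤ 0, DecidesBound U (fun h => (g h).1) s k}, V s ∈ U :=
    Filter.inter_mem (g ψ).2
      ((Filter.biInter_mem (f := (U : Filter ℕ)) (hYfin 0)).2 fun s _ => hVU s)
  obtain ⟨s, hsY, -, hsA⟩ := hYpos _ hAU
  have hs0 : s ∈ {s : Finset ℕ | s.Nonempty ∧
      ∀ k ≤ 0, DecidesBound U (fun h => (g h).1) s k} := by
    by_contra hs0
    refine hV s (hYne s hsY) (fun hd => hs0 ⟨hYne s hsY, fun k hk => ?_⟩)
      fun x hx => Set.mem_iInter₂.1 (hsA hx).2 s ⟨hsY, hs0⟩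
    rwa [Nat.le_zero.1 hk]
  have hbound := hM s (l s) ((hl s hs0).2 _ le_rfl) _ hAU ψ
    (Set.union_subset (fun x hx => (hsA hx).1) fun x hx => hx.1)
  have hle : M s (l s) ≤ (hlfin (l s)).toFinset.sup (fun t => M t (l s)) :=
    Finset.le_sup (f := fun t => M t (l s)) ((Set.Finite.mem_toFinset _).2 ⟨hsY, rfl⟩)
  have : ψ (l s) = (hlfin (l s)).toFinset.sup (fun t => M t (l s)) + 1 := rfl
  omega
end

section
/- Let U be a p-point on ω and suppose there is a map φ : U → U^ω that is monotone from (U,⊇) to (U^ω, pointwise ⊇) (i.e. Y ⊆ Z implies φ(Y)_n ⊆ φ(Z)_n for all n) and cofinal (i.e. for every sequence ⟨B_n : n < ω⟩ of members of U there is A ∈ U with φ(A)_n ⊆ B_n for all n). Then U is canonically Tukey above (ω^ω,≤*). -/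
open Set Filter

/-- A p-point contains, for every sequence `A` of its members, a set that is almost contained in
`A n` with no error past `n`, for infinitely many `n`. -/
theorem IsPPoint.exists_frequently_inter_Ici_subset {U : Ultrafilter ℕ} (hU : IsPPoint U)
    {A : ℕ → Set ℕ} (hA : ∀ n, A n ∈ U) :
    ∃ X ∈ U, ∀ N, ∃ n, N ≤ n ∧ X ∩ Ici n ⊆ A n := by
  obtain ⟨B, hB, hBA⟩ := hU.2 A hA
  have hbound : ∀ n, ∃ m, n < m ∧ B ∩ Ici m ⊆ A n := by
    intro n
    obtain ⟨b, hb⟩ := (hBA n).bddAbove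
    refine ⟨max b n + 1, by omega, fun x ⟨hxB, hx⟩ => ?_⟩
    by_contra hxA
    have hxb : x ≤ b := hb ⟨hxB, hxA⟩
    have hx' : max b n + 1 ≤ x := hx
    omega
  choose h hlt hsub using hbound
  have hsucc : ∀ i, h^[i + 1] 0 = h (h^[i] 0) := fun i => Function.iterate_succ_apply' h i 0
  have hmono : StrictMono fun i => h^[i] 0 :=
    strictMono_nat_of_lt_succ fun i => by simpa only [hsucc] using hlt _
  set E : Set ℕ := {x | ∃ i, h^[2 * i] 0 ≤ x ∧ x < h^[2 * i + 1] 0} with hE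
  by_cases hEU : E ∈ U
  · refine ⟨B ∩ E, inter_mem hB hEU, fun N => ⟨h^[2 * N + 1] 0, ?_, ?_⟩⟩
    · have := hmono.le_apply (x := 2 * N + 1)
      omega
    · rintro x ⟨⟨hxB, i, hi, hi'⟩, hx⟩
      refine hsub _ ⟨hxB, ?_⟩
      have hNi : N < i := by
        by_contra hle
        exact absurd (hi'.trans_le ((hmono.monotone (by omega : 2 * i + 1 ≤ 2 * N + 1)).trans hx))
          (lt_irrefl _)
      rw [← hsucc]
      exact (hmono.monotone (by omega : 2 * N + 1 + 1 ≤ 2 * i)).trans hi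
  · refine ⟨B ∩ Eᶜ, inter_mem hB (Ultrafilter.compl_mem_iff_notMem.2 hEU),
      fun N => ⟨h^[2 * N] 0, ?_, ?_⟩⟩
    · have := hmono.le_apply (x := 2 * N)
      omega
    · rintro x ⟨⟨hxB, hxE⟩, hx⟩
      refine hsub _ ⟨hxB, ?_⟩
      rw [← hsucc]
      by_contra hcon
      exact hxE ⟨N, hx, not_le.1 hcon⟩

/-- Members of a p-point are unbounded. -/
theorem IsPPoint.exists_mem_ge {U : Ultrafilter ℕ} (hU : IsPPoint U) {Y : Set ℕ} (hY : Y ∈ U)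
    (m : ℕ) : ∃ b ∈ Y, m ≤ b := by
  by_contra! hcon
  obtain ⟨a, -, ha⟩ := Ultrafilter.eq_pure_of_finite_mem
    ((finite_Iio m).subset fun b hb => hcon b hb) hY
  exact hU.1 a ha

/-- `s` forces `j` into the value of `ψ` when `j ∈ ψ (s ∪ A)` for every `A ∈ U`. -/
def ForcesMem (U : Ultrafilter ℕ) (ψ : Set ℕ → Set ℕ) (s : Set ℕ) (j : ℕ) : Prop :=
  ∀ A ∈ U, j ∈ ψ (s ∪ A)

theorem ForcesMem.mono {U : Ultrafilter ℕ} {ψ : Set ℕ → Set ℕ}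
    (hψ : ∀ Y ∈ U, ∀ Z ∈ U, Y ⊆ Z → ψ Y ⊆ ψ Z) {s t : Set ℕ} (hst : s ⊆ t) {j : ℕ}
    (h : ForcesMem U ψ s j) : ForcesMem U ψ t j := fun A hA =>
  hψ _ (mem_of_superset hA subset_union_right) _ (mem_of_superset hA subset_union_right)
    (union_subset_union_left A hst) (h A hA)

theorem ForcesMem.mem {U : Ultrafilter ℕ} {ψ : Set ℕ → Set ℕ} {s Y : Set ℕ} (hY : Y ∈ U)
    (hs : s ⊆ Y) {j : ℕ} (h : ForcesMem U ψ s j) : j ∈ ψ Y := by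
  simpa only [union_eq_self_of_subset_left hs] using h Y hY

/-- Monotone maps on a p-point are continuous below some member: membership in `φ Y k` is forced
by arbitrarily long initial segments of `Y`. -/
theorem IsPPoint.exists_forcesMem_inter_Iio {U : Ultrafilter ℕ} (hU : IsPPoint U)
    {φ : Set ℕ → ℕ → Set ℕ}
    (hmono : ∀ Y ∈ U, ∀ Z ∈ U, Y ⊆ Z → ∀ n : ℕ, φ Y n ⊆ φ Z n) :
    ∃ X ∈ U, ∀ Y ∈ U, Y ⊆ X → ∀ k, ∀ j ∈ φ Y k, ∀ N, ∃ n, N ≤ n ∧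
      ForcesMem U (φ · k) (Y ∩ Iio n) j := by
  have hdec : ∀ (s : Finset ℕ) (k j : ℕ), ∃ A ∈ U,
      j ∈ φ (↑s ∪ A) k → ForcesMem U (φ · k) ↑s j := by
    intro s k j
    by_cases hf : ForcesMem U (φ · k) ↑s j
    · exact ⟨univ, univ_mem, fun _ => hf⟩
    · unfold ForcesMem at hf
      push Not at hf
      obtain ⟨A, hA, hj⟩ := hf
      exact ⟨A, hA, fun h => absurd h hj⟩
  choose A hAU hA using hdec
  obtain ⟨X, hX, hXA⟩ := hU.exists_frequently_inter_Ici_subset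
    (A := fun n => ⋂ s ∈ (Finset.range n).powerset, ⋂ k ∈ Finset.range n,
      ⋂ j ∈ Finset.range n, A s k j) fun n => by
    refine (biInter_finset_mem _).2 fun s _ => (biInter_finset_mem _).2 fun k _ =>
      (biInter_finset_mem _).2 fun j _ => hAU s k j
  refine ⟨X, hX, fun Y hY hYX k j hj N => ?_⟩
  obtain ⟨n, hn, hXn⟩ := hXA (max N (max (k + 1) (j + 1)))
  refine ⟨n, by omega, ?_⟩
  have hfin : (Y ∩ Iio n).Finite := (finite_Iio n).subset inter_subset_right
  have hcover : Y ⊆ ↑hfin.toFinset ∪ A hfin.toFinset k j := by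
    intro x hx
    rcases lt_or_ge x n with hxn | hxn
    · exact Or.inl (by simpa using ⟨hx, hxn⟩)
    · right
      have hmem := hXn ⟨hYX hx, hxn⟩
      simp only [mem_iInter] at hmem
      refine hmem _ (Finset.mem_powerset.2 fun y hy => ?_) k (Finset.mem_range.2 (by omega)) j
        (Finset.mem_range.2 (by omega))
      exact Finset.mem_range.2 (hfin.mem_toFinset.1 hy).2
  simpa only [hfin.coe_toFinset] using
    hA _ _ _ (hmono _ hY _ (mem_of_superset hY hcover) hcover k hj)

theorem isLeast_sInf_of_nonempty {S : Set ℕ} (hS : S.Nonempty) : IsLeast S (sInf S) :=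
  ⟨Nat.sInf_mem hS, fun _ => Nat.sInf_le⟩

open Classical in
/-- The finite approximation to `Y ↦ min (φ Y k)`: the least element which `s` forces into
`φ · k`, defined for those `k` bounded by an element of `s`. -/
noncomputable def forcedMin (U : Ultrafilter ℕ) (φ : Set ℕ → ℕ → Set ℕ) (s : Set ℕ) (k : ℕ) :
    Option ℕ :=
  if (∃ b ∈ s, k ≤ b) ∧ ∃ j, ForcesMem U (φ · k) s j then
    some (sInf {j | ForcesMem U (φ · k) s j})
  else none

theorem forcedMin_eq_some {U : Ultrafilter ℕ} {φ : Set ℕ → ℕ → Set ℕ} {s : Set ℕ} {k v : ℕ} :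
    forcedMin U φ s k = some v ↔
      (∃ b ∈ s, k ≤ b) ∧ IsLeast {j | ForcesMem U (φ · k) s j} v := by
  unfold forcedMin
  split_ifs with h
  · have hl := isLeast_sInf_of_nonempty (S := {j | ForcesMem U (φ · k) s j}) h.2
    rw [Option.some_inj]
    exact ⟨fun hv => ⟨h.1, hv ▸ hl⟩, fun hv => hl.unique hv.2⟩
  · simp only [false_iff]
    exact fun hv => h ⟨hv.1, v, hv.2.1⟩

theorem finite_isSome_forcedMin (U : Ultrafilter ℕ) (φ : Set ℕ → ℕ → Set ℕ) {s : Set ℕ}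
    (hs : s.Finite) : {m | (forcedMin U φ s m).isSome}.Finite := by
  obtain ⟨b, hb⟩ := hs.bddAbove
  refine (finite_Iic b).subset fun m hm => ?_
  obtain ⟨v, hv⟩ := Option.isSome_iff_exists.1 hm
  obtain ⟨⟨c, hc, hmc⟩, -⟩ := forcedMin_eq_some.1 hv
  exact hmc.trans (hb hc)

theorem forcedMin_anti {U : Ultrafilter ℕ} {φ : Set ℕ → ℕ → Set ℕ}
    (hmono : ∀ Y ∈ U, ∀ Z ∈ U, Y ⊆ Z → ∀ n : ℕ, φ Y n ⊆ φ Z n) {s t : Set ℕ} (hst : s ⊆ t)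
    {k v : ℕ} (h : forcedMin U φ s k = some v) : ∃ w, forcedMin U φ t k = some w ∧ w ≤ v := by
  obtain ⟨⟨b, hb, hkb⟩, hv⟩ := forcedMin_eq_some.1 h
  have hvt : ForcesMem U (φ · k) t v :=
    ForcesMem.mono (fun Y hY Z hZ hYZ => hmono Y hY Z hZ hYZ k) hst hv.1
  have hl := isLeast_sInf_of_nonempty (S := {j | ForcesMem U (φ · k) t j}) ⟨v, hvt⟩
  exact ⟨_, forcedMin_eq_some.2 ⟨⟨b, hst hb, hkb⟩, hl⟩, hl.2 hvt⟩

/-- Theorem: if `U` is a p-point and there is a monotone cofinal map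
`φ : (U, ⊇) → (U^ω, pointwise ⊇)`, then `U` is canonically Tukey above `(ω^ω, ≤*)`. -/
theorem stmt_7 (U : Ultrafilter ℕ) (hU : IsPPoint U)
    (φ : Set ℕ → ℕ → Set ℕ)
    (hmem : ∀ A ∈ U, ∀ n : ℕ, φ A n ∈ U)
    (hmono : ∀ Y ∈ U, ∀ Z ∈ U, Y ⊆ Z → ∀ n : ℕ, φ Y n ⊆ φ Z n)
    (hcof : ∀ B : ℕ → Set ℕ, (∀ n, B n ∈ U) → ∃ A ∈ U, ∀ n, φ A n ⊆ B n) :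
    CanonTukeyAbove U := by
  have hne : ∀ A ∈ U, ∀ k, (φ A k).Nonempty := fun A hA k => U.nonempty_of_mem (hmem A hA k)
  obtain ⟨X, hX, hcont⟩ := hU.exists_forcesMem_inter_Iio hmono
  have hmin : ∀ Y ∈ U, Y ⊆ X → ∀ k, ∃ n, forcedMin U φ (Y ∩ Iio n) k = some (sInf (φ Y k)) := by
    intro Y hY hYX k
    obtain ⟨b, hb, hkb⟩ := hU.exists_mem_ge hY k
    obtain ⟨n, hn, hforce⟩ := hcont Y hY hYX k _ (Nat.sInf_mem (hne Y hY k)) (b + 1)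
    exact ⟨n, forcedMin_eq_some.2 ⟨⟨b, ⟨hb, hn⟩, hkb⟩, hforce,
      fun j hj => Nat.sInf_le (ForcesMem.mem (ψ := (φ · k)) hY inter_subset_left hj)⟩⟩
  refine ⟨fun A k => sInf (φ A k), forcedMin U φ, fun s hs => finite_isSome_forcedMin U φ hs,
    ?_, ?_, fun s t _ _ hst k v h => forcedMin_anti hmono hst h, ?_, X, hX, ?_⟩
  · exact fun A hA B hB hBA => Eventually.of_forall fun k =>
      Nat.sInf_le (hmono B hB A hA hBA k (Nat.sInf_mem (hne B hB k)))
  · intro g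
    have htail : ∀ n, Ici (g n) ∈ U := fun n => by
      by_contra hnot
      obtain ⟨b, hb, hgb⟩ := hU.exists_mem_ge (Ultrafilter.compl_mem_iff_notMem.2 hnot) (g n)
      exact hb hgb
    obtain ⟨A, hA, hsub⟩ := hcof _ htail
    exact ⟨A, hA, Eventually.of_forall fun n => hsub n (Nat.sInf_mem (hne A hA n))⟩
  · intro s _ A hA _ m
    obtain ⟨n, hn⟩ := hmin (A ∩ X) (inter_mem hA hX) inter_subset_right m
    obtain ⟨w, hw, -⟩ := forcedMin_anti hmono (subset_union_right (s := s)) hn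
    exact ⟨A ∩ X ∩ Iio n, (finite_Iio n).subset inter_subset_right,
      inter_subset_left.trans inter_subset_left, by simp [hw]⟩
  · intro Y hY hYX k
    refine (IsLeast.csInf_eq (s := {v | ∃ n, forcedMin U φ (Y ∩ Iio n) k = some v})
      ⟨hmin Y hY hYX k, ?_⟩).symm
    rintro v ⟨n, hn⟩
    exact Nat.sInf_le (ForcesMem.mem (ψ := (φ · k)) hY inter_subset_left
      (forcedMin_eq_some.1 hn).2.1)
end

section
/- Let U be a p-point on ω and let φ : U → P(ω)^ω be monotone from (U,⊇) to (P(ω)^ω, pointwise ⊇), i.e. Y ⊆ Z implies φ(Y)_n ⊆ φ(Z)_n for all n. Identify each sequence ⟨A_n : n < ω⟩ ∈ P(ω)^ω with the subset {(n,m) : m ∈ A_n} of ω×ω. Then there exist X* ∈ U and a map ψ from finite subsets of ω to finite subsets of ω×ω such that: (i) for every Y ∈ U with Y ⊆ X*, φ(Y) = ⋃_{n<ω} ψ(Y ∩ [0,n)) (as subsets of ω×ω); and (ii) ψ is monotone, i.e. s ⊆ t implies ψ(s) ⊆ ψ(t). -/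
open Set Filter

/-- A p-point contains, for every sequence `X` of its members, a set `W` whose tail beyond `n`
lies in `X n` for unboundedly many `n`. -/
theorem IsPPoint.exists_diff_Iio_subset {U : Ultrafilter ℕ} (hU : IsPPoint U)
    (X : ℕ → Set ℕ) (hX : ∀ n, X n ∈ U) :
    ∃ W ∈ U, ∀ k, ∃ n, k ≤ n ∧ W \ Iio n ⊆ X n := by
  obtain ⟨B, hB, hBX⟩ := hU.2 X hX
  have hbd : ∀ n, ∃ g, ∀ x ∈ B, g ≤ x → x ∈ X n := by
    intro n
    obtain ⟨b, hb⟩ := (hBX n).bddAbove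
    refine ⟨b + 1, fun x hx hle => ?_⟩
    by_contra hnot
    have := hb ⟨hx, hnot⟩
    omega
  choose g hg using hbd
  obtain ⟨m, hm_succ⟩ : ∃ m : ℕ → ℕ, ∀ i, m (i + 1) = max (m i + 1) (g (m i)) :=
    ⟨fun i => Nat.rec 0 (fun _ a => max (a + 1) (g a)) i, fun _ => rfl⟩
  have hm : StrictMono m := strictMono_nat_of_lt_succ fun i => by rw [hm_succ]; omega
  have hgm : ∀ i, g (m i) ≤ m (i + 1) := fun i => by rw [hm_succ]; omega
  let E : Set ℕ := {x | ∃ i, m (2 * i) ≤ x ∧ x < m (2 * i + 1)}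
  rcases U.mem_or_compl_mem E with hE | hE
  · refine ⟨B ∩ E, inter_mem hB hE, fun k => ⟨m (2 * k + 1), ?_, ?_⟩⟩
    · have := hm.id_le (2 * k + 1)
      simp only [id] at this
      omega
    · rintro x ⟨⟨hxB, j, hj, hj'⟩, hx⟩
      simp only [mem_Iio, not_lt] at hx
      have hkj : 2 * k + 1 < 2 * j + 1 := hm.lt_iff_lt.1 (hx.trans_lt hj')
      have hle : m (2 * k + 1 + 1) ≤ m (2 * j) :=
        hm.monotone (by omega)
      exact hg _ x hxB ((hgm _).trans (hle.trans hj))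
  · refine ⟨B ∩ Eᶜ, inter_mem hB hE, fun k => ⟨m (2 * k), ?_, ?_⟩⟩
    · have := hm.id_le (2 * k)
      simp only [id] at this
      omega
    · rintro x ⟨⟨hxB, hxE⟩, hx⟩
      simp only [mem_Iio, not_lt] at hx
      have hle : m (2 * k + 1) ≤ x := by
        by_contra hlt
        exact hxE ⟨k, hx, not_le.1 hlt⟩
      exact hg _ x hxB ((hgm _).trans hle)

/-- Given predicates `P k` on the members of an ultrafilter, some member `W` decides `P k` for
`k ≤ n` on all initial segments below `n`: a failure of `P k` at `Z` persists at
some member containing `(Z ∩ [0,n)) ∪ (W \ [0,n))`. -/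
theorem Ultrafilter.exists_deciding_tail (U : Ultrafilter ℕ) (P : ℕ → Set ℕ → Prop)
    (n : ℕ) :
    ∃ W ∈ U, ∀ k ≤ n, ∀ Z ∈ U, ¬ P k Z →
      ∃ Z' ∈ U, ¬ P k Z' ∧ Z ∩ Iio n ∪ W \ Iio n ⊆ Z' := by
  have hW : ∀ q : ℕ × Set ℕ, ∃ W ∈ U, ∀ Z ∈ U, Z ∩ Iio n = q.2 → ¬ P q.1 Z →
      ∃ Z' ∈ U, ¬ P q.1 Z' ∧ Z ∩ Iio n ∪ W \ Iio n ⊆ Z' := by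
    intro q
    by_cases h : ∃ Z ∈ U, Z ∩ Iio n = q.2 ∧ ¬ P q.1 Z
    · obtain ⟨Z₀, hZ₀, hs, hP⟩ := h
      refine ⟨Z₀, hZ₀, fun Z _ hZs _ => ⟨Z₀, hZ₀, hP, ?_⟩⟩
      rw [hZs, ← hs]
      exact union_subset inter_subset_left sdiff_subset
    · exact ⟨univ, univ_mem, fun Z hZ hs hP => (h ⟨Z, hZ, hs, hP⟩).elim⟩
  choose V hVU hV using hW
  have hfin : (Iic n ×ˢ 𝒫 (Iio n) : Set (ℕ × Set ℕ)).Finite :=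
    (finite_Iic n).prod (finite_Iio n).finite_subsets
  refine ⟨⋂ q ∈ (Iic n ×ˢ 𝒫 (Iio n) : Set (ℕ × Set ℕ)), V q,
    (biInter_mem hfin).2 fun q _ => hVU q, fun k hk Z hZ hP => ?_⟩
  obtain ⟨Z', hZ', hP', hsub⟩ := hV (k, Z ∩ Iio n) Z hZ rfl hP
  refine ⟨Z', hZ', hP', (union_subset_union_right _ (sdiff_subset_sdiff_left ?_)).trans hsub⟩
  exact biInter_subset_of_mem ⟨hk, inter_subset_right⟩

/-- Theorem: if `U` is a p-point and `φ : U → P(ω)^ω` is monotone (pointwise reverse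
inclusion), identifying each sequence `⟨A_n⟩` with `{(n,m) : m ∈ A_n} ⊆ ω × ω`,
then there are `X* ∈ U` and a monotone map `ψ` from finite subsets of `ω` to finite
subsets of `ω × ω` with `φ(Y) = ⋃_n ψ(Y ∩ [0,n))` for every `Y ∈ U` with `Y ⊆ X*`. -/
theorem stmt_8 (U : Ultrafilter ℕ) (hU : IsPPoint U)
    (φ : Set ℕ → ℕ → Set ℕ)
    (hmono : ∀ Y ∈ U, ∀ Z ∈ U, Y ⊆ Z → ∀ n : ℕ, φ Y n ⊆ φ Z n) :
    ∃ Xstar ∈ U, ∃ ψ : Set ℕ → Set (ℕ × ℕ),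
      (∀ s : Set ℕ, s.Finite → (ψ s).Finite) ∧
      (∀ Y ∈ U, Y ⊆ Xstar →
        {p : ℕ × ℕ | p.2 ∈ φ Y p.1} = ⋃ n : ℕ, ψ (Y ∩ Set.Iio n)) ∧
      (∀ s t : Set ℕ, s.Finite → t.Finite → s ⊆ t → ψ s ⊆ ψ t) := by
  have hcof : (U : Filter ℕ) ≤ cofinite := (U.le_cofinite_or_eq_pure).resolve_right
    fun ⟨a, ha⟩ => hU.1 a ha
  let P : ℕ → Set ℕ → Prop := fun k Y => ∀ p : ℕ × ℕ, Encodable.encode p = k → p.2 ∈ φ Y p.1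
  choose V hVU hV using U.exists_deciding_tail P
  obtain ⟨X, hXU, hX⟩ := hU.exists_diff_Iio_subset V hVU
  have htail : ∀ n, X \ Iio n ∈ U := fun n =>
    inter_mem hXU (hcof (finite_Iio n).compl_mem_cofinite)
  have hmem : ∀ (s : Set ℕ) (n : ℕ), s ∪ X \ Iio n ∈ U := fun s n =>
    mem_of_superset (htail n) subset_union_right
  have htrunc : ∀ (Y : Set ℕ) (N n x : ℕ), n ≤ x → x < N →
      Y ∩ Iio N ∩ Iio n = Y ∩ Iio n := by
    intro Y N n x hnx hxN
    rw [inter_assoc, Iio_inter_Iio, min_eq_right (hnx.trans hxN.le)]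
  refine ⟨X, hXU, fun s => {p | ∃ n, Encodable.encode p ≤ n ∧ X \ Iio n ⊆ V n ∧
    (∃ x ∈ s, n ≤ x) ∧ p.2 ∈ φ (s ∩ Iio n ∪ X \ Iio n) p.1}, ?_, ?_, ?_⟩
  · intro s hs
    obtain ⟨b, hb⟩ := hs.bddAbove
    refine ((finite_Iic b).preimage Encodable.encode_injective.injOn).subset ?_
    rintro p ⟨n, hpn, -, ⟨x, hxs, hnx⟩, -⟩
    exact hpn.trans (hnx.trans (hb hxs))
  · intro Y hY hYX
    ext p
    simp only [mem_ofPred_eq, mem_iUnion]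
    constructor
    · intro hp
      obtain ⟨n, hpn, hn⟩ := hX (Encodable.encode p)
      obtain ⟨x, hxY, hnx⟩ : ∃ x ∈ Y, n ≤ x := by
        obtain ⟨x, hxY, hx⟩ := U.nonempty_of_mem
          (inter_mem hY (hcof (finite_Iio n).compl_mem_cofinite))
        exact ⟨x, hxY, not_lt.1 hx⟩
      refine ⟨x + 1, n, hpn, hn, ⟨x, ⟨hxY, Nat.lt_succ_self x⟩, hnx⟩, ?_⟩
      rw [htrunc Y _ n x hnx (Nat.lt_succ_self x)]
      refine hmono Y hY _ (hmem _ n) (fun y hy => ?_) _ hp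
      by_cases hyn : y < n
      · exact Or.inl ⟨hy, hyn⟩
      · exact Or.inr ⟨hYX hy, hyn⟩
    · rintro ⟨N, n, hpn, hn, ⟨x, ⟨-, hxN⟩, hnx⟩, hp⟩
      rw [htrunc Y _ n x hnx hxN] at hp
      by_contra hnot
      obtain ⟨Z', hZ', hP', hsub⟩ := hV n _ hpn Y hY fun h => hnot (h p rfl)
      refine hP' fun q hq => ?_
      obtain rfl := Encodable.encode_injective hq
      refine hmono _ (hmem _ n) Z' hZ' (Subset.trans ?_ hsub) _ hp
      exact union_subset_union_right _ fun y hy => ⟨hn hy, hy.2⟩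
  · rintro s t - - hst p ⟨n, hpn, hn, ⟨x, hxs, hnx⟩, hp⟩
    exact ⟨n, hpn, hn, ⟨x, hst hxs, hnx⟩, hmono _ (hmem _ n) _ (hmem _ n)
      (union_subset_union_left _ (inter_subset_inter_left _ hst)) _ hp⟩
end

section
/- Let U be a nonprincipal ultrafilter on ω whose character χ(U) is strictly less than the dominating number 𝔡. Then U^{<ω} is a P⁺-filter (i.e. U is Canjar). -/
open Set Filter

/-- The dominating number `𝔡`: least cardinality of a family `D ⊆ ω^ω` such that
every `g` is everywhere dominated by some member of `D`. -/
noncomputable def dominatingNumber : Cardinal :=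
  sInf {c : Cardinal | ∃ D : Set (ℕ → ℕ), Cardinal.mk ↥D = c ∧
    ∀ g : ℕ → ℕ, ∃ f ∈ D, domLE g f}

/-- The character `χ(U)`: least cardinality of a base of `U`. -/
noncomputable def charUF (U : Ultrafilter ℕ) : Cardinal :=
  sInf {c : Cardinal | ∃ B : Set (Set ℕ), (∀ A ∈ B, A ∈ U) ∧ Cardinal.mk ↥B = c ∧
    ∀ A ∈ U, ∃ B' ∈ B, B' ⊆ A}

/-- The bounding number `𝔟`: least cardinality of a family `F ⊆ ω^ω` unbounded
in `(ω^ω, ≤*)`. -/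
noncomputable def boundingNumber : Cardinal :=
  sInf {c : Cardinal | ∃ F : Set (ℕ → ℕ), Cardinal.mk ↥F = c ∧
    ¬ ∃ g : ℕ → ℕ, ∀ f ∈ F, evDomLE f g}

/-- The character of an ultrafilter is attained by some base. -/
lemma exists_base_mk_eq_charUF (U : Ultrafilter ℕ) :
    ∃ B : Set (Set ℕ), (∀ A ∈ B, A ∈ U) ∧ Cardinal.mk ↥B = charUF U ∧
      ∀ A ∈ U, ∃ B' ∈ B, B' ⊆ A :=
  csInf_mem (s := {c : Cardinal | ∃ B : Set (Set ℕ), (∀ A ∈ B, A ∈ U) ∧ Cardinal.mk ↥B = c ∧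
    ∀ A ∈ U, ∃ B' ∈ B, B' ⊆ A})
    ⟨_, {A | A ∈ U}, fun _ hA => hA, rfl, fun A hA => ⟨A, hA, Subset.rfl⟩⟩

/-- A family of fewer than `𝔡` functions is not dominating: some `g` exceeds each member
somewhere. -/
lemma exists_forall_exists_lt {ι : Type} (F : ι → ℕ → ℕ)
    (h : Cardinal.mk ι < dominatingNumber) : ∃ g : ℕ → ℕ, ∀ i, ∃ n, F i n < g n := by
  by_contra! hF
  refine (Cardinal.mk_range_le (f := F)).not_gt (h.trans_le (csInf_le' ⟨range F, rfl, fun g => ?_⟩))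
  obtain ⟨i, hi⟩ := hF g
  exact ⟨F i, mem_range_self i, hi⟩

/-- Theorem: if `U` is a nonprincipal ultrafilter on `ω` with `χ(U) < 𝔡`,
then `U^{<ω}` is a P⁺-filter (i.e. `U` is Canjar). -/
theorem stmt_10 (U : Ultrafilter ℕ) (hU : ∀ a : ℕ, U ≠ pure a)
    (h : charUF U < dominatingNumber) : PPlus U := by
  intro X hX hdec
  obtain ⟨B, hBU, hcard, hB⟩ := exists_base_mk_eq_charUF U
  have hanti : Antitone X := antitone_nat_of_succ_le hdec
  choose s hs using fun (b : B) n => (hX n).2 b (hBU b b.2)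
  obtain ⟨g, hg⟩ := exists_forall_exists_lt (fun b n => Encodable.encode (s b n)) (hcard ▸ h)
  have hfin : ∀ m, {t : Finset ℕ | Encodable.encode t < g m}.Finite := fun m =>
    (finite_Iio (g m)).preimage Encodable.encode_injective.injOn
  refine ⟨{t | ∃ n, t ∈ X n ∧ Encodable.encode t < g n},
    ⟨fun t ⟨n, ht, _⟩ => (hX n).1 t ht, fun A hA => ?_⟩, fun n => ?_⟩
  · obtain ⟨b, hb, hbA⟩ := hB A hA
    obtain ⟨n, hn⟩ := hg ⟨b, hb⟩
    obtain ⟨hsX, hne, hsub⟩ := hs ⟨b, hb⟩ n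
    exact ⟨_, ⟨n, hsX, hn⟩, hne, hsub.trans hbA⟩
  · refine ((finite_Iio n).biUnion fun m _ => hfin m).subset ?_
    rintro t ⟨⟨m, htX, htg⟩, htn⟩
    exact mem_biUnion (lt_of_not_ge fun hnm => htn (hanti hnm htX)) htg
end

section
/- Let U be a nonprincipal ultrafilter on ω that is a P_{𝔟⁺}-point, i.e. every family 𝒳 ⊆ U of cardinality at most 𝔟 has a pseudo-intersection in U (some A ∈ U with A \ X finite for every X ∈ 𝒳). Then U^{<ω} is a P⁺-filter (i.e. U is Canjar). -/
open Set Filter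

/-- There is an unbounded family in `(ω^ω, ≤*)` of cardinality `𝔟`. -/
theorem exists_unbounded_mk_eq_boundingNumber :
    ∃ F : Set (ℕ → ℕ), Cardinal.mk ↥F = boundingNumber ∧
      ¬ ∃ g : ℕ → ℕ, ∀ f ∈ F, evDomLE f g := by
  refine csInf_mem (s := {c : Cardinal | ∃ F : Set (ℕ → ℕ), Cardinal.mk ↥F = c ∧
    ¬ ∃ g : ℕ → ℕ, ∀ f ∈ F, evDomLE f g}) ⟨_, univ, rfl, ?_⟩
  rintro ⟨g, hg⟩
  obtain ⟨n, hn⟩ := (hg (fun n => g n + 1) (mem_univ _)).exists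
  exact Nat.not_succ_le_self _ hn

/-- A countable union of `≤*`-bounded families is `≤*`-bounded. -/
theorem exists_evDomLE_of_forall_nat {F : ℕ → Set (ℕ → ℕ)}
    (h : ∀ k, ∃ g : ℕ → ℕ, ∀ f ∈ F k, evDomLE f g) :
    ∃ g : ℕ → ℕ, ∀ k, ∀ f ∈ F k, evDomLE f g := by
  choose g hg using h
  refine ⟨fun n => (Finset.range (n + 1)).sup fun k => g k n, fun k f hf => ?_⟩
  filter_upwards [hg k f hf, eventually_ge_atTop k] with n hn hkn
  exact hn.trans (Finset.le_sup (f := fun k => g k n)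
    (Finset.mem_range.2 (Nat.lt_succ_of_le hkn)))

/-- A nonprincipal ultrafilter on `ω` contains all final segments. -/
theorem Ioi_mem_of_forall_ne_pure {U : Ultrafilter ℕ} (hU : ∀ a : ℕ, U ≠ pure a) (k : ℕ) :
    Ioi k ∈ U := by
  by_contra h
  have hk : Iic k ∈ U := by simpa using Ultrafilter.compl_mem_iff_notMem.2 h
  obtain ⟨a, -, ha⟩ := Ultrafilter.eq_pure_of_finite_mem (finite_Iic k) hk
  exact hU a ha

/-- The diagonal union `⋃ n, X n ∩ 𝒫(f n)` of a sequence of families of finite sets. -/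
def diagUnion (X : ℕ → Set (Finset ℕ)) (f : ℕ → ℕ) : Set (Finset ℕ) :=
  {s | ∃ n, s ∈ X n ∧ s ⊆ Finset.range (f n)}

theorem finite_diagUnion_diff {X : ℕ → Set (Finset ℕ)} (hX : Antitone X) (f : ℕ → ℕ) (n : ℕ) :
    (diagUnion X f \ X n).Finite := by
  refine ((Finset.range n).biUnion fun m => (Finset.range (f m)).powerset).finite_toSet.subset ?_
  rintro s ⟨⟨m, hsm, hsf⟩, hsn⟩
  have hmn : m < n := lt_of_not_ge fun hnm => hsn (hX hnm hsm)
  exact Finset.mem_biUnion.2 ⟨m, Finset.mem_range.2 hmn, Finset.mem_powerset.2 hsf⟩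

/-- If the diagonal unions over `F` all miss `[A]^{<ω}` while every `X n` meets it, then `F` is
`≤*`-bounded. -/
theorem exists_evDomLE_of_diagUnion_disjoint {X : ℕ → Set (Finset ℕ)} {A : Set ℕ}
    (hX : ∀ n, (X n ∩ FinCube A).Nonempty) {F : Set (ℕ → ℕ)}
    (hF : ∀ f ∈ F, ¬ (diagUnion X f ∩ FinCube A).Nonempty) :
    ∃ g : ℕ → ℕ, ∀ f ∈ F, evDomLE f g := by
  choose s hs using hX
  refine ⟨fun n => (s n).sup id + 1, fun f hf => Eventually.of_forall fun n => ?_⟩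
  by_contra hlt
  refine hF f hf ⟨s n, ⟨n, (hs n).1, fun x hx => Finset.mem_range.2 ?_⟩, (hs n).2⟩
  have : x ≤ (s n).sup id := Finset.le_sup (f := id) hx
  exact (Nat.lt_succ_of_le this).trans (not_le.1 hlt)

/-- Theorem: if `U` is a nonprincipal `P_{𝔟⁺}`-point (every subfamily of `U` of size
at most `𝔟` has a pseudo-intersection in `U`), then `U^{<ω}` is a P⁺-filter
(i.e. `U` is Canjar). -/
theorem stmt_11 (U : Ultrafilter ℕ) (hU : ∀ a : ℕ, U ≠ pure a)
    (hP : ∀ 𝒳 : Set (Set ℕ), (∀ A ∈ 𝒳, A ∈ U) → Cardinal.mk ↥𝒳 ≤ boundingNumber →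
      ∃ A ∈ U, ∀ X ∈ 𝒳, (A \ X).Finite) :
    PPlus U := by
  intro X hX hdec
  have hanti : Antitone X := antitone_nat_of_succ_le hdec
  obtain ⟨F, hFcard, hF⟩ := exists_unbounded_mk_eq_boundingNumber
  by_contra hno
  have hex : ∀ f, ∃ A ∈ U, ¬ (diagUnion X f ∩ FinCube A).Nonempty := by
    intro f
    by_contra! hpos
    exact hno ⟨diagUnion X f, ⟨fun s ⟨n, hs, _⟩ => (hX n).1 s hs, hpos⟩,
      finite_diagUnion_diff hanti f⟩
  choose B hBU hB using hex
  obtain ⟨A, hAU, hA⟩ := hP (B '' F) (by rintro _ ⟨f, -, rfl⟩; exact hBU f)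
    (Cardinal.mk_image_le.trans hFcard.le)
  have hbdd : ∀ k, ∃ g : ℕ → ℕ, ∀ f ∈ {f ∈ F | A \ B f ⊆ Iic k}, evDomLE f g := by
    intro k
    have hAk : A ∩ Ioi k ∈ U := inter_mem hAU (Ioi_mem_of_forall_ne_pure hU k)
    refine exists_evDomLE_of_diagUnion_disjoint (fun n => (hX n).2 _ hAk) ?_
    rintro f ⟨-, hf⟩ ⟨s, hsX, hs, hsA⟩
    refine hB f ⟨s, hsX, hs, fun x hx => ?_⟩
    by_contra hxB
    exact not_lt_of_ge (mem_Iic.1 (hf ⟨(hsA hx).1, hxB⟩)) (mem_Ioi.1 (hsA hx).2)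
  obtain ⟨g, hg⟩ := exists_evDomLE_of_forall_nat hbdd
  refine hF ⟨g, fun f hf => ?_⟩
  obtain ⟨k, hk⟩ := (hA _ (mem_image_of_mem B hf)).bddAbove
  exact hg k f ⟨hf, fun x hx => hk hx⟩
end

section
/- Let μ be a lower semicontinuous submeasure on P(ω) that is finite on finite sets, and let φ be the associated map defined on {X ⊆ ω : μ(X) = ∞}. Then for every X ⊆ ω with μ(X) = ∞ and every f ∈ ω^ω, there exists X' ⊆ X with μ(X') = ∞ such that f(n) ≤ φ(X')(n) for every n ∈ ω. -/
open Set Filter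

/-- The map `φ` associated to a submeasure `μ`: `φ(X)(0) = min X` and
`φ(X)(n+1)` is the least `m > φ(X)(n)` with `μ(X ∩ (φ(X)(n), m]) > n + 1`. -/
noncomputable def phiMap (μ : Set ℕ → ENNReal) (X : Set ℕ) : ℕ → ℕ
  | 0 => sInf X
  | n + 1 => sInf {m : ℕ | phiMap μ X n < m ∧
      ((n : ENNReal) + 1) < μ (X ∩ Set.Ioc (phiMap μ X n) m)}

theorem exists_lt_submeasure_inter_Ioc {μ : Set ℕ → ENNReal}
    (hmono : ∀ A B : Set ℕ, A ⊆ B → μ A ≤ μ B)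
    (hsub : ∀ A B : Set ℕ, μ (A ∪ B) ≤ μ A + μ B)
    (hlsc : ∀ A : Set ℕ, Tendsto (fun n : ℕ => μ (A ∩ Iio n)) atTop (nhds (μ A)))
    (hfin : ∀ s : Set ℕ, s.Finite → μ s ≠ ⊤)
    {X : Set ℕ} (hX : μ X = ⊤) (a : ℕ) {c : ENNReal} (hc : c ≠ ⊤) :
    ∃ m, a < m ∧ c < μ (X ∩ Ioc a m) := by
  have hK := hfin (Iic a) (finite_Iic a)
  have hlt : μ (Iic a) + c < μ X := by
    rw [hX]
    exact (ENNReal.add_ne_top.2 ⟨hK, hc⟩).lt_top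
  obtain ⟨m, hm, ham⟩ :=
    (((hlsc X).eventually_const_lt hlt).and (eventually_gt_atTop a)).exists
  refine ⟨m, ham, ?_⟩
  have hcover : X ∩ Iio m ⊆ Iic a ∪ X ∩ Ioc a m := by
    intro x hx
    rcases le_or_gt x a with h | h
    · exact Or.inl h
    · exact Or.inr ⟨hx.1, h, hx.2.le⟩
  have h := hm.trans_le ((hmono _ _ hcover).trans (hsub _ _))
  exact (ENNReal.add_lt_add_iff_left hK).1 h

theorem phiMap_succ_spec {μ : Set ℕ → ENNReal}
    (hmono : ∀ A B : Set ℕ, A ⊆ B → μ A ≤ μ B)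
    (hsub : ∀ A B : Set ℕ, μ (A ∪ B) ≤ μ A + μ B)
    (hlsc : ∀ A : Set ℕ, Tendsto (fun n : ℕ => μ (A ∩ Iio n)) atTop (nhds (μ A)))
    (hfin : ∀ s : Set ℕ, s.Finite → μ s ≠ ⊤)
    {X : Set ℕ} (hX : μ X = ⊤) (n : ℕ) :
    (n : ENNReal) + 1 < μ (X ∩ Ioc (phiMap μ X n) (phiMap μ X (n + 1))) := by
  rw [phiMap]
  exact (Nat.sInf_mem (exists_lt_submeasure_inter_Ioc hmono hsub hlsc hfin hX (phiMap μ X n)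
    (c := (n : ENNReal) + 1) (by simp))).2

theorem phiMap_zero_mem {μ : Set ℕ → ENNReal} (h0 : μ ∅ = 0) {X : Set ℕ} (hX : μ X = ⊤) :
    phiMap μ X 0 ∈ X := by
  rw [phiMap]
  refine Nat.sInf_mem (nonempty_iff_ne_empty.2 ?_)
  rintro rfl
  simp [h0] at hX

/-- If the values of `μ` on points of `X` are unbounded, a sparse sequence in `X` works. -/
theorem exists_le_phiMap_of_unbounded {μ : Set ℕ → ENNReal} (h0 : μ ∅ = 0)
    (hmono : ∀ A B : Set ℕ, A ⊆ B → μ A ≤ μ B)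
    (hsub : ∀ A B : Set ℕ, μ (A ∪ B) ≤ μ A + μ B)
    (hlsc : ∀ A : Set ℕ, Tendsto (fun n : ℕ => μ (A ∩ Iio n)) atTop (nhds (μ A)))
    (hfin : ∀ s : Set ℕ, s.Finite → μ s ≠ ⊤)
    {X : Set ℕ} (hunb : ∀ c : ENNReal, c ≠ ⊤ → ∃ x ∈ X, c < μ {x}) (f : ℕ → ℕ) :
    ∃ X' : Set ℕ, X' ⊆ X ∧ μ X' = ⊤ ∧ ∀ n : ℕ, f n ≤ phiMap μ X' n := by
  have hfreq : ∀ n, ∃ᶠ k in atTop, k ∈ X ∧ f n ≤ k ∧ (n : ENNReal) < μ {k} := by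
    intro n
    refine frequently_atTop.2 fun N => ?_
    have hK := hfin (Iio (max N (f n))) (finite_Iio _)
    obtain ⟨x, hxX, hx⟩ := hunb (max (μ (Iio (max N (f n)))) n) (by simp [hK])
    have hle : max N (f n) ≤ x := by
      by_contra! h
      exact (hmono {x} _ (singleton_subset_iff.2 h)).not_gt ((le_max_left _ _).trans_lt hx)
    exact ⟨x, (le_max_left _ _).trans hle, hxX, (le_max_right _ _).trans hle,
      (le_max_right _ _).trans_lt hx⟩
  obtain ⟨x, hx, hxs⟩ := extraction_forall_of_frequently hfreq
  have htop : μ (range x) = ⊤ := by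
    refine ENNReal.eq_top_of_forall_nnreal_le fun r => ?_
    obtain ⟨n, hn⟩ := exists_nat_ge r
    calc (r : ENNReal) ≤ n := by exact_mod_cast hn
      _ ≤ μ {x n} := (hxs n).2.2.le
      _ ≤ μ (range x) := hmono _ _ (singleton_subset_iff.2 (mem_range_self n))
  have hle : ∀ n, x n ≤ phiMap μ (range x) n := by
    intro n
    induction n with
    | zero =>
      obtain ⟨k, hk⟩ := phiMap_zero_mem h0 htop
      exact hk ▸ hx.monotone (Nat.zero_le k)
    | succ n ih =>
      have hspec := phiMap_succ_spec hmono hsub hlsc hfin htop n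
      have hne : (range x ∩ Ioc (phiMap μ (range x) n) (phiMap μ (range x) (n + 1))).Nonempty := by
        rw [nonempty_iff_ne_empty]
        intro h
        simp [h, h0] at hspec
      obtain ⟨_, ⟨k, rfl⟩, hk, hk'⟩ := hne
      exact (hx.monotone (hx.lt_iff_lt.1 (ih.trans_lt hk))).trans hk'
  exact ⟨range x, range_subset_iff.2 fun n => (hxs n).1, htop,
    fun n => (hxs n).2.1.trans (hle n)⟩

/-- If the values of `μ` on points of `X` are bounded, a maximal subset of `X` whose initial
segments below `f n` have submeasure at most `n` works. -/
theorem exists_le_phiMap_of_bounded {μ : Set ℕ → ENNReal} (h0 : μ ∅ = 0)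
    (hmono : ∀ A B : Set ℕ, A ⊆ B → μ A ≤ μ B)
    (hsub : ∀ A B : Set ℕ, μ (A ∪ B) ≤ μ A + μ B)
    (hlsc : ∀ A : Set ℕ, Tendsto (fun n : ℕ => μ (A ∩ Iio n)) atTop (nhds (μ A)))
    (hfin : ∀ s : Set ℕ, s.Finite → μ s ≠ ⊤)
    {X : Set ℕ} (hX : μ X = ⊤) {c : ENNReal} (hc : c ≠ ⊤) (hb : ∀ x ∈ X, μ {x} ≤ c)
    (f : ℕ → ℕ) :
    ∃ X' : Set ℕ, X' ⊆ X ∧ μ X' = ⊤ ∧ ∀ n : ℕ, f n ≤ phiMap μ X' n := by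
  obtain ⟨S, hS⟩ := zorn_subset
    {S : Set ℕ | S ⊆ X ∩ Ici (f 0) ∧ ∀ n : ℕ, μ (S ∩ Iio (f n)) ≤ n} <| by
    intro C hC hchain
    rcases C.eq_empty_or_nonempty with rfl | hCne
    · exact ⟨∅, by simp [h0], by simp⟩
    refine ⟨⋃₀ C, ⟨sUnion_subset fun s hs => (hC hs).1, fun n => ?_⟩,
      fun s hs => subset_sUnion_of_mem hs⟩
    obtain ⟨t, htC, ht⟩ := hchain.directedOn.exists_mem_subset_of_finite_of_subset_sUnion
      hCne ((finite_Iio (f n)).subset inter_subset_right)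
      (inter_subset_left : ⋃₀ C ∩ Iio (f n) ⊆ ⋃₀ C)
    exact (hmono _ _ (subset_inter ht inter_subset_right)).trans ((hC htC).2 n)
  have htop : μ S = ⊤ := by
    by_contra hSfin
    obtain ⟨k, hk⟩ := ENNReal.exists_nat_gt (ENNReal.add_ne_top.2 ⟨hSfin, hc⟩)
    obtain ⟨N, hN⟩ := ((finite_Iic k).image f).bddAbove
    have hfN : ∀ n ≤ k, f n ≤ N := fun n hn => hN (mem_image_of_mem f hn)
    have hcover : X ⊆ Iio N ∪ S := by
      intro x hx
      rcases lt_or_ge x N with h | h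
      · exact Or.inl h
      refine Or.inr (hS.le_of_ge (y := S ∪ {x}) ⟨?_, fun n => ?_⟩ subset_union_left (Or.inr rfl))
      · exact union_subset hS.prop.1
          (singleton_subset_iff.2 ⟨hx, (hfN 0 (Nat.zero_le k)).trans h⟩)
      rcases le_total n k with hn | hn
      · refine (hmono _ _ ?_).trans (hS.prop.2 n)
        rintro y ⟨hy | rfl, hyf⟩
        · exact ⟨hy, hyf⟩
        · exact absurd hyf (not_lt.2 ((hfN n hn).trans h))
      · calc μ ((S ∪ {x}) ∩ Iio (f n)) ≤ μ (S ∪ {x}) := hmono _ _ inter_subset_left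
          _ ≤ μ S + μ {x} := hsub _ _
          _ ≤ μ S + c := by gcongr; exact hb x hx
          _ ≤ k := hk.le
          _ ≤ n := by exact_mod_cast hn
    have h := (hmono _ _ hcover).trans (hsub _ _)
    rw [hX, top_le_iff] at h
    exact ENNReal.add_ne_top.2 ⟨hfin _ (finite_Iio N), hSfin⟩ h
  refine ⟨S, fun x hx => (hS.prop.1 hx).1, htop, fun n => ?_⟩
  cases n with
  | zero => exact (hS.prop.1 (phiMap_zero_mem h0 htop)).2
  | succ n =>
    by_contra! h
    have hlt := phiMap_succ_spec hmono hsub hlsc hfin htop n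
    have hle := hS.prop.2 (n + 1)
    push_cast at hle
    exact ((hmono _ _ (inter_subset_inter_right S fun y hy => hy.2.trans_lt h)).trans hle).not_gt hlt

/-- Theorem: for a lower semicontinuous submeasure `μ` on `P(ω)` finite on finite
sets, for every `X` with `μ(X) = ∞` and every `f ∈ ω^ω` there is `X' ⊆ X` with
`μ(X') = ∞` and `f(n) ≤ φ(X')(n)` for all `n`. -/
theorem stmt_14 (μ : Set ℕ → ENNReal) (h0 : μ ∅ = 0)
    (hmono : ∀ A B : Set ℕ, A ⊆ B → μ A ≤ μ B)
    (hsub : ∀ A B : Set ℕ, μ (A ∪ B) ≤ μ A + μ B)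
    (hlsc : ∀ A : Set ℕ,
      Filter.Tendsto (fun n : ℕ => μ (A ∩ Set.Iio n)) Filter.atTop (nhds (μ A)))
    (hfin : ∀ s : Set ℕ, s.Finite → μ s ≠ ⊤)
    (X : Set ℕ) (hX : μ X = ⊤) (f : ℕ → ℕ) :
    ∃ X' : Set ℕ, X' ⊆ X ∧ μ X' = ⊤ ∧ ∀ n : ℕ, f n ≤ phiMap μ X' n := by
  by_cases hb : ∃ c : ENNReal, c ≠ ⊤ ∧ ∀ x ∈ X, μ {x} ≤ c
  · obtain ⟨c, hc, hb⟩ := hb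
    exact exists_le_phiMap_of_bounded h0 hmono hsub hlsc hfin hX hc hb f
  · push Not at hb
    exact exists_le_phiMap_of_unbounded h0 hmono hsub hlsc hfin hb f
end
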